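/- arXiv:2204.06841 — 10 statements merged into one kernel-verified Lean document; each statement's English description precedes it below -/
import Mathlib

section
/- Let n ≥ 2 and let Ω ⊂ ℂⁿ be a bounded strongly pseudoconvex domain with defining function ρ of class C⁴ on an open set U₀ ⊇ closure(Ω). Then there exist an open set U with bΩ ⊆ U ⊆ U₀ and a constant c > 0 with the following property: for every z ∈ U ∩ Ω and every v ∈ ℂⁿ with |v| = 1 and ∂ρ(z)(v) = 0 there is an injective holomorphic map g = g_{z,v} : 𝔻 → U₀ with g(0) = z, g′(0) = c·v, and g′(ζ) ≠ 0 for all ζ ∈ 𝔻, such that the connected component D of {ζ ∈ 𝔻 : ρ(g(ζ)) < 0} containing 0 has compact closure contained in 𝔻, and for every ζ in the frontier of D one has ρ(g(ζ)) = 0 and the real differential of the function ζ ↦ ρ(g(ζ)) at ζ is nonzero. Moreover the maps g_{z,v} can be chosen so that (z, v, ζ) ↦ g_{z,v}(ζ) is continuous on its domain {(z,v) : z ∈ U ∩ Ω, |v| = 1, ∂ρ(z)(v) = 0} × 𝔻. -/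
open Complex Metric Set Bornology

/-- Second real Fréchet derivative. -/
noncomputable def D2 {E : Type*} [NormedAddCommGroup E] [NormedSpace ℝ E]
    (ρ : E → ℝ) (z w v : E) : ℝ := fderiv ℝ (fderiv ℝ ρ) z w v

/-- The Levi form `L_ρ(z,w) = (1/4)(D²ρ(z)(w,w) + D²ρ(z)(iw,iw))`. -/
noncomputable def levi {E : Type*} [NormedAddCommGroup E] [NormedSpace ℂ E]
    (ρ : E → ℝ) (z w : E) : ℝ :=
  (1/4) * (D2 ρ z w w + D2 ρ z (Complex.I • w) (Complex.I • w))

/-- The complex differential `∂ρ(z)(w) = (1/2)(Dρ(z)(w) − i·Dρ(z)(iw))`. -/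
noncomputable def cdiff {E : Type*} [NormedAddCommGroup E] [NormedSpace ℂ E]
    (ρ : E → ℝ) (z w : E) : ℂ :=
  (1/2 : ℂ) * ((fderiv ℝ ρ z w : ℂ) - Complex.I * (fderiv ℝ ρ z (Complex.I • w) : ℂ))

section TangentDiscs

open Filter Topology

variable {E : Type*} [NormedAddCommGroup E] [InnerProductSpace ℂ E]

/-- The quadratic disc `ξ ↦ z + ξ v + ξ² a`. -/
noncomputable def quadDisc (z v a : E) (ξ : ℂ) : E := z + ξ • v + ξ ^ 2 • a

/-- The second derivative of `t ↦ ρ (quadDisc z v a (t η))` at the parameter `ξ = t η`. -/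
noncomputable def raySecondDeriv (ρ : E → ℝ) (z v a : E) (η ξ : ℂ) : ℝ :=
  D2 ρ (quadDisc z v a ξ) (η • v + (2 * η * ξ) • a) (η • v + (2 * η * ξ) • a) +
    fderiv ℝ ρ (quadDisc z v a ξ) ((2 * η ^ 2) • a)

/-- The coefficient `q` of the pluriharmonic part of the second-order Taylor term:
`D²ρ(z)(ηv, ηv) = 2|η|² L_ρ(z,v) + Re (η² q)`. -/
noncomputable def pluriharmonicCoeff (ρ : E → ℝ) (z v : E) : ℂ :=
  (((D2 ρ z v v - D2 ρ z (I • v) (I • v)) / 2 : ℝ) : ℂ) - (D2 ρ z v (I • v) : ℝ) * I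

lemma D2_smul_smul {ρ : E → ℝ} {z : E} (hρ : ContDiffAt ℝ 2 ρ z) (v : E) (η : ℂ) :
    D2 ρ z (η • v) (η • v) =
      2 * ‖η‖ ^ 2 * levi ρ z v + (η ^ 2 * pluriharmonicCoeff ρ z v).re := by
  have hsymm : D2 ρ z (I • v) v = D2 ρ z v (I • v) :=
    (hρ.isSymmSndFDerivAt (by simp)) (I • v) v
  have hη : η • v = η.re • v + η.im • (I • v) := by
    conv_lhs => rw [← Complex.re_add_im η]
    rw [add_smul, mul_smul, Complex.coe_smul, Complex.coe_smul]
  have hexp : D2 ρ z (η • v) (η • v) = η.re ^ 2 * D2 ρ z v v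
      + 2 * (η.re * η.im) * D2 ρ z v (I • v) + η.im ^ 2 * D2 ρ z (I • v) (I • v) := by
    rw [hη]
    simp only [D2, map_add, map_smul, add_apply, smul_apply, smul_eq_mul] at hsymm ⊢
    rw [hsymm]
    ring
  rw [hexp, ← Complex.normSq_eq_norm_sq, Complex.normSq_apply]
  simp only [levi, pluriharmonicCoeff, pow_two, Complex.mul_re, Complex.mul_im, Complex.sub_re,
    Complex.sub_im, Complex.ofReal_re, Complex.ofReal_im, Complex.I_re, Complex.I_im]
  ring

lemma ContDiffAt.continuousAt_fderiv_of_two {ρ : E → ℝ} {z : E} (hρ : ContDiffAt ℝ 2 ρ z) :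
    ContinuousAt (fderiv ℝ ρ) z :=
  (hρ.fderiv_right (m := 1) (by norm_num)).continuousAt

lemma ContDiffAt.continuousAt_fderiv_fderiv {ρ : E → ℝ} {z : E} (hρ : ContDiffAt ℝ 2 ρ z) :
    ContinuousAt (fderiv ℝ (fderiv ℝ ρ)) z :=
  ((hρ.fderiv_right (m := 1) (by norm_num)).fderiv_right (m := 0) (by norm_num)).continuousAt

lemma ContDiffAt.continuousAt_D2 {X : Type*} [TopologicalSpace X] {ρ : E → ℝ} {f u w : X → E}
    {x : X} (hρ : ContDiffAt ℝ 2 ρ (f x)) (hf : ContinuousAt f x) (hu : ContinuousAt u x)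
    (hw : ContinuousAt w x) : ContinuousAt (fun y => D2 ρ (f y) (u y) (w y)) x := by
  have h : ContinuousAt (fun y => fderiv ℝ (fderiv ℝ ρ) (f y)) x :=
    ContinuousAt.comp (g := fderiv ℝ (fderiv ℝ ρ)) hρ.continuousAt_fderiv_fderiv hf
  exact (h.clm_apply hu).clm_apply hw

section Correction

variable [CompleteSpace E]

/-- The vector `N` with `⟪N, w⟫ = 2 ∂ρ(z)(w)` for all `w`. -/
noncomputable def complexGradient (ρ : E → ℝ) (z : E) : E :=
  (InnerProductSpace.toDual ℂ E).symm
    (StrongDual.extendRCLikeₗᵢ (𝕜 := ℂ) (fderiv ℝ ρ z))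

/-- The quadratic coefficient removing the pluriharmonic second-order term of `ρ` along the disc
through `z` in direction `v`. -/
noncomputable def discCorrection (ρ : E → ℝ) (z v : E) : E :=
  (-(pluriharmonicCoeff ρ z v / 2) / ((‖complexGradient ρ z‖ ^ 2 : ℝ) : ℂ)) • complexGradient ρ z

lemma inner_complexGradient (ρ : E → ℝ) (z w : E) :
    inner ℂ (complexGradient ρ z) w =
      (fderiv ℝ ρ z w : ℂ) - I * (fderiv ℝ ρ z (I • w) : ℂ) := by
  rw [complexGradient, InnerProductSpace.toDual_symm_apply]
  exact StrongDual.extendRCLike_apply (𝕜 := ℂ) _ _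

lemma fderiv_eq_re_inner_complexGradient (ρ : E → ℝ) (z w : E) :
    fderiv ℝ ρ z w = (inner ℂ (complexGradient ρ z) w).re := by
  simp [inner_complexGradient]

lemma inner_complexGradient_eq_zero {ρ : E → ℝ} {z v : E} (hv : cdiff ρ z v = 0) :
    inner ℂ (complexGradient ρ z) v = 0 := by
  rw [inner_complexGradient]
  simpa [cdiff] using hv

lemma complexGradient_ne_zero {ρ : E → ℝ} {z : E} (hz : fderiv ℝ ρ z ≠ 0) :
    complexGradient ρ z ≠ 0 := by
  simpa [complexGradient] using hz

lemma inner_discCorrection {ρ : E → ℝ} {z : E} (hz : fderiv ℝ ρ z ≠ 0) (v : E) :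
    inner ℂ (complexGradient ρ z) (discCorrection ρ z v) = -(pluriharmonicCoeff ρ z v / 2) := by
  have hN : ((‖complexGradient ρ z‖ ^ 2 : ℝ) : ℂ) ≠ 0 := by
    simpa using complexGradient_ne_zero hz
  rw [discCorrection, inner_smul_right, inner_self_eq_norm_sq_to_K]
  push_cast at hN ⊢
  exact div_mul_cancel₀ _ hN

lemma inner_discCorrection_eq_zero {ρ : E → ℝ} {z v : E} (hv : cdiff ρ z v = 0) :
    inner ℂ v (discCorrection ρ z v) = 0 := by
  rw [discCorrection, inner_smul_right, inner_eq_zero_symm.mp (inner_complexGradient_eq_zero hv),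
    mul_zero]

lemma raySecondDeriv_zero {ρ : E → ℝ} {z : E} (hρ : ContDiffAt ℝ 2 ρ z)
    (hz : fderiv ℝ ρ z ≠ 0) (v : E) {η : ℂ} (hη : ‖η‖ = 1) :
    raySecondDeriv ρ z v (discCorrection ρ z v) η 0 = 2 * levi ρ z v := by
  have h : (2 * η ^ 2) * -(pluriharmonicCoeff ρ z v / 2) = -(η ^ 2 * pluriharmonicCoeff ρ z v) := by
    ring
  simp only [raySecondDeriv, quadDisc, zero_smul, mul_zero, add_zero, ne_eq, OfNat.ofNat_ne_zero,
    not_false_eq_true, zero_pow]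
  rw [D2_smul_smul hρ, fderiv_eq_re_inner_complexGradient, inner_smul_right,
    inner_discCorrection hz, h, hη, Complex.neg_re]
  ring

lemma continuousAt_discCorrection {ρ : E → ℝ} {p : E × E} (hρ : ContDiffAt ℝ 2 ρ p.1)
    (hz : fderiv ℝ ρ p.1 ≠ 0) :
    ContinuousAt (fun p : E × E => discCorrection ρ p.1 p.2) p := by
  have hN : ContinuousAt (fun p : E × E => complexGradient ρ p.1) p := by
    have h : ContinuousAt (fun p : E × E => fderiv ℝ ρ p.1) p :=
      ContinuousAt.comp (g := fderiv ℝ ρ) hρ.continuousAt_fderiv_of_two continuousAt_fst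
    exact (InnerProductSpace.toDual ℂ E).symm.continuous.continuousAt.comp
      ((StrongDual.extendRCLikeₗᵢ (𝕜 := ℂ) (F := E)).continuous.continuousAt.comp h)
  have hI : ContinuousAt (fun p : E × E => I • p.2) p := by fun_prop
  have hq : ContinuousAt (fun p : E × E => pluriharmonicCoeff ρ p.1 p.2) p := by
    have h1 := hρ.continuousAt_D2 continuousAt_fst continuousAt_snd continuousAt_snd
    have h2 := hρ.continuousAt_D2 continuousAt_fst hI hI
    have h3 := hρ.continuousAt_D2 continuousAt_fst continuousAt_snd hI
    unfold pluriharmonicCoeff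
    fun_prop
  unfold discCorrection
  refine ContinuousAt.smul (ContinuousAt.div (hq.div_const 2).neg ?_ ?_) hN
  · fun_prop
  · simpa using complexGradient_ne_zero hz

/-- Near a compact set of regular points, the second derivative of `ρ` along the corrected discs is
uniformly positive on a uniform neighbourhood of their centres. -/
lemma exists_uniform_raySecondDeriv_gt [FiniteDimensional ℂ E] {U₀ K : Set E} {ρ : E → ℝ}
    (hU₀ : IsOpen U₀) (hρ : ContDiffOn ℝ 2 ρ U₀)
    (hpsh : ∀ z ∈ U₀, ∀ w : E, w ≠ 0 → 0 < levi ρ z w)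
    (hK : IsCompact K) (hKU : K ⊆ U₀) (hKρ : ∀ z ∈ K, fderiv ℝ ρ z ≠ 0) :
    ∃ r > 0, ∀ z ∈ K, ∀ v : E, ‖v‖ = 1 → ∀ η : ℂ, ‖η‖ = 1 → ∀ ξ : ℂ, ‖ξ‖ < r →
      quadDisc z v (discCorrection ρ z v) ξ ∈ U₀ ∧
      r < raySecondDeriv ρ z v (discCorrection ρ z v) η ξ := by
  have : ProperSpace E := FiniteDimensional.proper ℂ E
  have hev : ∀ᶠ x : ℂ × ℝ in 𝓝 (0, 0),
      ∀ y ∈ (K ×ˢ sphere (0 : E) 1) ×ˢ sphere (0 : ℂ) 1,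
        quadDisc y.1.1 y.1.2 (discCorrection ρ y.1.1 y.1.2) x.1 ∈ U₀ ∧
        x.2 < raySecondDeriv ρ y.1.1 y.1.2 (discCorrection ρ y.1.1 y.1.2) y.2 x.1 := by
    refine ((hK.prod (isCompact_sphere 0 1)).prod
      (isCompact_sphere 0 1)).eventually_forall_of_forall_eventually ?_
    rintro ⟨⟨z, v⟩, η⟩ ⟨⟨hz, hv⟩, hη⟩
    have hv1 : ‖v‖ = 1 := by simpa using hv
    have hη1 : ‖η‖ = 1 := by simpa using hη
    have hzU := hKU hz
    have hρz : ContDiffAt ℝ 2 ρ z := hρ.contDiffAt (hU₀.mem_nhds hzU)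
    set p : (ℂ × ℝ) × ((E × E) × ℂ) := ((0, 0), ((z, v), η)) with hp
    have ha : ContinuousAt (fun p : (ℂ × ℝ) × ((E × E) × ℂ) =>
        discCorrection ρ p.2.1.1 p.2.1.2) p :=
      ContinuousAt.comp (g := fun p : E × E => discCorrection ρ p.1 p.2)
        (f := fun p : (ℂ × ℝ) × ((E × E) × ℂ) => p.2.1)
        (continuousAt_discCorrection hρz (hKρ z hz)) (by fun_prop)
    have hdisc : ContinuousAt (fun p : (ℂ × ℝ) × ((E × E) × ℂ) =>
        quadDisc p.2.1.1 p.2.1.2 (discCorrection ρ p.2.1.1 p.2.1.2) p.1.1) p := by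
      unfold quadDisc
      fun_prop
    have hdisc0 : quadDisc p.2.1.1 p.2.1.2 (discCorrection ρ p.2.1.1 p.2.1.2) p.1.1 = z := by
      simp [quadDisc, hp]
    have hsnd : ContinuousAt (fun p : (ℂ × ℝ) × ((E × E) × ℂ) =>
        raySecondDeriv ρ p.2.1.1 p.2.1.2 (discCorrection ρ p.2.1.1 p.2.1.2) p.2.2 p.1.1) p := by
      have hdir : ContinuousAt (fun p : (ℂ × ℝ) × ((E × E) × ℂ) =>
          p.2.2 • p.2.1.2 + (2 * p.2.2 * p.1.1) • discCorrection ρ p.2.1.1 p.2.1.2) p := by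
        fun_prop
      have hacc : ContinuousAt (fun p : (ℂ × ℝ) × ((E × E) × ℂ) =>
          (2 * p.2.2 ^ 2) • discCorrection ρ p.2.1.1 p.2.1.2) p := by
        fun_prop
      have hD : ContinuousAt (fun p : (ℂ × ℝ) × ((E × E) × ℂ) => fderiv ℝ ρ
          (quadDisc p.2.1.1 p.2.1.2 (discCorrection ρ p.2.1.1 p.2.1.2) p.1.1)) p :=
        ContinuousAt.comp (g := fderiv ℝ ρ)
          (by rw [hdisc0]; exact hρz.continuousAt_fderiv_of_two) hdisc
      exact (ContDiffAt.continuousAt_D2 (by rw [hdisc0]; exact hρz) hdisc hdir hdir).add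
        (hD.clm_apply hacc)
    have hpar : ContinuousAt (fun p : (ℂ × ℝ) × ((E × E) × ℂ) => p.1.2) p := by fun_prop
    refine (hdisc.eventually_mem (by rw [hdisc0]; exact hU₀.mem_nhds hzU)).and
      (hpar.eventually_lt hsnd ?_)
    change 0 < raySecondDeriv ρ z v (discCorrection ρ z v) η 0
    rw [raySecondDeriv_zero hρz (hKρ z hz) v hη1]
    have := hpsh z hzU v (by rintro rfl; simp at hv1)
    positivity
  obtain ⟨ε, hε, hball⟩ := Metric.eventually_nhds_iff.mp hev
  refine ⟨ε / 2, by positivity, fun z hz v hv η hη ξ hξ => ?_⟩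
  have hdist : dist ((ξ, ε / 2) : ℂ × ℝ) (0, 0) < ε := by
    rw [Prod.dist_eq, max_lt_iff]
    refine ⟨by simpa using hξ.trans (half_lt_self hε), ?_⟩
    rw [Real.dist_eq, sub_zero, abs_of_pos (by positivity)]
    exact half_lt_self hε
  exact hball hdist ((z, v), η) ⟨⟨hz, by simpa using hv⟩, by simpa using hη⟩

end Correction

lemma hasDerivAt_quadDisc (z v a : E) (ξ : ℂ) :
    HasDerivAt (quadDisc z v a) (v + (2 * ξ) • a) ξ := by
  have h1 := ((hasDerivAt_id ξ).smul_const v).const_add z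
  have h2 := (hasDerivAt_pow 2 ξ).smul_const a
  exact (h1.add h2).congr_deriv (by simp)

lemma hasDerivAt_quadDisc_ray (z v a : E) (η : ℂ) (t : ℝ) :
    HasDerivAt (fun t : ℝ => quadDisc z v a (t * η)) (η • v + (2 * η * (t * η)) • a) t := by
  have h1 : HasDerivAt (fun t : ℝ => (t : ℂ) * η) η t := by
    simpa using (Complex.ofRealCLM.hasDerivAt (x := t)).mul_const η
  refine ((hasDerivAt_quadDisc z v a (t * η)).scomp t h1).congr_deriv ?_
  rw [smul_add, smul_smul]
  congr 2
  ring

lemma hasDerivAt_comp_quadDisc_ray {ρ : E → ℝ} {z v a : E} {η : ℂ} {t : ℝ}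
    (hρ : ContDiffAt ℝ 2 ρ (quadDisc z v a (t * η))) :
    HasDerivAt (fun t : ℝ => ρ (quadDisc z v a (t * η)))
      (fderiv ℝ ρ (quadDisc z v a (t * η)) (η • v + (2 * η * (t * η)) • a)) t :=
  (hρ.differentiableAt (by norm_num)).hasFDerivAt.comp_hasDerivAt t
    (hasDerivAt_quadDisc_ray z v a η t)

lemma hasDerivAt_fderiv_quadDisc_ray {ρ : E → ℝ} {z v a : E} {η : ℂ} {t : ℝ}
    (hρ : ContDiffAt ℝ 2 ρ (quadDisc z v a (t * η))) :
    HasDerivAt (fun t : ℝ =>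
        fderiv ℝ ρ (quadDisc z v a (t * η)) (η • v + (2 * η * (t * η)) • a))
      (raySecondDeriv ρ z v a η (t * η)) t := by
  have h1 : HasDerivAt (fun t : ℝ => fderiv ℝ ρ (quadDisc z v a (t * η)))
      (fderiv ℝ (fderiv ℝ ρ) (quadDisc z v a (t * η)) (η • v + (2 * η * (t * η)) • a)) t :=
    ((hρ.fderiv_right (m := 1) (by norm_num)).differentiableAt
      (by norm_num)).hasFDerivAt.comp_hasDerivAt t (hasDerivAt_quadDisc_ray z v a η t)
  have h2 : HasDerivAt (fun t : ℝ => η • v + (2 * η * (t * η)) • a) ((2 * η ^ 2) • a) t := by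
    have h3 : HasDerivAt (fun t : ℝ => 2 * η * ((t : ℂ) * η)) (2 * η ^ 2) t := by
      refine (((Complex.ofRealCLM.hasDerivAt (x := t)).mul_const η).const_mul (2 * η)).congr_deriv ?_
      rw [Complex.ofRealCLM_apply, Complex.ofReal_one]
      ring
    exact (h3.smul_const a).const_add _
  exact h1.clm_apply h2

/-- A function on `[0, c)` with vanishing initial slope and second derivative greater than `m ≥ 0`
is monotone and grows at least quadratically. -/
lemma strictly_convex_growth {f f' f'' : ℝ → ℝ} {c m : ℝ} (hm : 0 ≤ m)
    (hf : ∀ t ∈ Ico 0 c, HasDerivAt f (f' t) t) (hf' : ∀ t ∈ Ico 0 c, HasDerivAt f' (f'' t) t)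
    (h0 : f' 0 = 0) (hm' : ∀ t ∈ Ico 0 c, m < f'' t) :
    (∀ t ∈ Ico 0 c, m * t ≤ f' t) ∧ MonotoneOn f (Ico 0 c) ∧
      ∀ t ∈ Ico 0 c, f 0 + m * t ^ 2 / 2 ≤ f t := by
  have mono : ∀ {g g' : ℝ → ℝ}, (∀ t ∈ Ico 0 c, HasDerivAt g (g' t) t) →
      (∀ t ∈ Ico 0 c, 0 ≤ g' t) → MonotoneOn g (Ico 0 c) := fun {g g'} hg hg' =>
    monotoneOn_of_deriv_nonneg (convex_Ico 0 c)
      (fun t ht => (hg t ht).continuousAt.continuousWithinAt)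
      (fun t ht => (hg t (interior_subset ht)).differentiableAt.differentiableWithinAt)
      (fun t ht => by rw [(hg t (interior_subset ht)).deriv]; exact hg' t (interior_subset ht))
  have hslope : ∀ t ∈ Ico 0 c, m * t ≤ f' t := by
    intro t ht
    have h := mono (g := fun t => f' t - m * t) (g' := fun t => f'' t - m)
      (fun s hs => ((hf' s hs).sub ((hasDerivAt_id s).const_mul m)).congr_deriv (by simp))
      (fun s hs => (sub_pos.mpr (hm' s hs)).le) ⟨le_rfl, ht.1.trans_lt ht.2⟩ ht ht.1
    simp only [h0] at h
    linarith
  refine ⟨hslope, mono hf fun t ht => (mul_nonneg hm ht.1).trans (hslope t ht), fun t ht => ?_⟩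
  have h := mono (g := fun t => f t - m * t ^ 2 / 2) (g' := fun t => f' t - m * t)
    (fun s hs => by
      refine ((hf s hs).sub (((hasDerivAt_pow 2 s).const_mul m).div_const 2)).congr_deriv ?_
      norm_num
      ring)
    (fun s hs => sub_nonneg.mpr (hslope s hs)) ⟨le_rfl, ht.1.trans_lt ht.2⟩ ht ht.1
  simp only at h
  linarith

lemma injective_quadDisc {z v a : E} (hv : v ≠ 0) (hva : inner ℂ v a = 0) :
    Function.Injective (quadDisc z v a) := by
  intro ξ ξ' h
  have h' := congrArg (fun w => inner ℂ v (w - z)) h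
  have hvv : inner ℂ v v ≠ 0 := inner_self_ne_zero.mpr hv
  simpa [quadDisc, add_assoc, inner_add_right, inner_smul_right, hva, hv] using h'

lemma deriv_quadDisc_ne_zero {z v a : E} (hv : v ≠ 0) (hva : inner ℂ v a = 0) (ξ : ℂ) :
    deriv (quadDisc z v a) ξ ≠ 0 := by
  rw [(hasDerivAt_quadDisc z v a ξ).deriv]
  intro h
  have h' := congrArg (inner ℂ v) h
  simp [hva, hv] at h'

/-- Along a real-valued function on the unit disc which increases along rays and grows
quadratically, the component of the negative set containing `0` is relatively compact with
regular boundary. -/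
lemma sublevel_component_of_radial_growth {h : ℂ → ℝ} {R : ℝ} (hR : R < 1)
    (hcont : ContinuousOn h (ball 0 1)) (h0 : h 0 < 0)
    (hmono : ∀ ζ ∈ ball (0 : ℂ) 1, ∀ t ∈ Icc (0 : ℝ) 1, h (t • ζ) ≤ h ζ)
    (hsmall : ∀ ζ ∈ ball (0 : ℂ) 1, h ζ < 0 → ‖ζ‖ ≤ R)
    (hreg : ∀ ζ ∈ ball (0 : ℂ) 1, ζ ≠ 0 → fderiv ℝ h ζ ≠ 0) :
    IsCompact (closure (connectedComponentIn {ζ ∈ ball (0 : ℂ) 1 | h ζ < 0} 0)) ∧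
    closure (connectedComponentIn {ζ ∈ ball (0 : ℂ) 1 | h ζ < 0} 0) ⊆ ball 0 1 ∧
    ∀ ζ ∈ frontier (connectedComponentIn {ζ ∈ ball (0 : ℂ) 1 | h ζ < 0} 0),
      h ζ = 0 ∧ fderiv ℝ h ζ ≠ 0 := by
  set A : Set ℂ := {ζ ∈ ball (0 : ℂ) 1 | h ζ < 0} with hA
  have h0A : (0 : ℂ) ∈ A := ⟨by simp, h0⟩
  have hstar : StarConvex ℝ 0 A := by
    rw [starConvex_zero_iff]
    intro ζ hζ t ht0 ht1
    refine ⟨?_, (hmono ζ hζ.1 t ⟨ht0, ht1⟩).trans_lt hζ.2⟩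
    have hζ1 : ‖ζ‖ < 1 := by simpa using hζ.1
    have : t * ‖ζ‖ ≤ ‖ζ‖ := mul_le_of_le_one_left (norm_nonneg _) ht1
    rw [mem_ball_zero_iff, norm_smul, Real.norm_of_nonneg ht0]
    linarith
  rw [(hstar.isPathConnected h0A).isConnected.isPreconnected.connectedComponentIn h0A]
  have hAR : closure A ⊆ closedBall 0 R :=
    closure_minimal (fun ζ hζ => by simpa using hsmall ζ hζ.1 hζ.2) isClosed_closedBall
  have hA1 : closure A ⊆ ball 0 1 := hAR.trans (closedBall_subset_ball hR)
  have hAo : IsOpen A := hcont.isOpen_inter_preimage isOpen_ball isOpen_Iio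
  refine ⟨(isCompact_closedBall 0 R).of_isClosed_subset isClosed_closure hAR, hA1,
    fun ζ hζ => ?_⟩
  rw [hAo.frontier_eq] at hζ
  have hζ1 := hA1 hζ.1
  have hle : h ζ ≤ 0 := by
    have hc : ContinuousWithinAt h A ζ :=
      (hcont.continuousAt (isOpen_ball.mem_nhds hζ1)).continuousWithinAt
    have : (𝓝[A] ζ).NeBot := mem_closure_iff_nhdsWithin_neBot.mp hζ.1
    exact le_of_tendsto hc (eventually_mem_nhdsWithin.mono fun y hy => hy.2.le)
  refine ⟨hle.antisymm (not_lt.mp fun hlt => hζ.2 ⟨hζ1, hlt⟩), hreg ζ hζ1 ?_⟩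
  rintro rfl
  exact hζ.2 h0A

/-- The growth of `ρ` along a quadratic disc tangent to its level set, read off on rays. -/
lemma growth_along_ray {U₀ : Set E} {ρ : E → ℝ} {z v a : E} {η : ℂ} {r : ℝ} (hr : 0 < r)
    (hU₀ : IsOpen U₀) (hρ : ContDiffOn ℝ 2 ρ U₀) (hη : ‖η‖ = 1)
    (htan : fderiv ℝ ρ z (η • v) = 0)
    (hdisc : ∀ ξ : ℂ, ‖ξ‖ < r → quadDisc z v a ξ ∈ U₀ ∧ r < raySecondDeriv ρ z v a η ξ) :
    (∀ t ∈ Ico 0 r, HasDerivAt (fun t : ℝ => ρ (quadDisc z v a (t * η)))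
        (fderiv ℝ ρ (quadDisc z v a (t * η)) (η • v + (2 * η * (t * η)) • a)) t ∧
      r * t ≤ fderiv ℝ ρ (quadDisc z v a (t * η)) (η • v + (2 * η * (t * η)) • a)) ∧
    MonotoneOn (fun t : ℝ => ρ (quadDisc z v a (t * η))) (Ico 0 r) ∧
    ∀ t ∈ Ico 0 r, ρ z + r * t ^ 2 / 2 ≤ ρ (quadDisc z v a (t * η)) := by
  have hnorm : ∀ t ∈ Ico 0 r, ‖(t : ℂ) * η‖ < r := fun t ht => by
    simpa [hη, abs_of_nonneg ht.1] using ht.2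
  have hC : ∀ t ∈ Ico 0 r, ContDiffAt ℝ 2 ρ (quadDisc z v a (t * η)) := fun t ht =>
    hρ.contDiffAt (hU₀.mem_nhds (hdisc _ (hnorm t ht)).1)
  obtain ⟨h1, h2, h3⟩ := strictly_convex_growth hr.le
    (fun t ht => hasDerivAt_comp_quadDisc_ray (hC t ht))
    (fun t ht => hasDerivAt_fderiv_quadDisc_ray (hC t ht))
    (by simpa [quadDisc] using htan) (fun t ht => (hdisc _ (hnorm t ht)).2)
  refine ⟨fun t ht => ⟨hasDerivAt_comp_quadDisc_ray (hC t ht), h1 t ht⟩, h2, ?_⟩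
  simpa [quadDisc] using h3

lemma sublevel_component_quadDisc {U₀ : Set E} {ρ : E → ℝ} {z v a : E} {r : ℝ} (hr : 0 < r)
    (hU₀ : IsOpen U₀) (hρ : ContDiffOn ℝ 2 ρ U₀) (htan : ∀ η : ℂ, fderiv ℝ ρ z (η • v) = 0)
    (hdisc : ∀ η : ℂ, ‖η‖ = 1 → ∀ ξ : ℂ, ‖ξ‖ < r →
      quadDisc z v a ξ ∈ U₀ ∧ r < raySecondDeriv ρ z v a η ξ)
    (hz : ρ z < 0) (hz' : -(r ^ 3 / 8) < ρ z) :
    let A := {ζ ∈ ball (0 : ℂ) 1 | ρ (quadDisc z v a (r * ζ)) < 0}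
    IsCompact (closure (connectedComponentIn A 0)) ∧
    closure (connectedComponentIn A 0) ⊆ ball 0 1 ∧
    ∀ ζ ∈ frontier (connectedComponentIn A 0), ρ (quadDisc z v a (r * ζ)) = 0 ∧
      fderiv ℝ (fun ξ => ρ (quadDisc z v a (r * ξ))) ζ ≠ 0 := by
  have hgrowth := fun η (hη : ‖η‖ = 1) => growth_along_ray hr hU₀ hρ hη (htan η) (hdisc η hη)
  have hmem : ∀ ζ ∈ ball (0 : ℂ) 1, quadDisc z v a (r * ζ) ∈ U₀ := fun ζ hζ => by
    refine (hdisc 1 (by simp) (r * ζ) ?_).1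
    rw [norm_mul, Complex.norm_real, Real.norm_of_nonneg hr.le]
    exact mul_lt_of_lt_one_right hr (by simpa using hζ)
  have hdiff : ∀ ζ ∈ ball (0 : ℂ) 1,
      DifferentiableAt ℝ (fun ξ : ℂ => ρ (quadDisc z v a (r * ξ))) ζ := fun ζ hζ => by
    have h1 : DifferentiableAt ℝ ρ (quadDisc z v a (r * ζ)) :=
      (hρ.contDiffAt (hU₀.mem_nhds (hmem ζ hζ))).differentiableAt (by norm_num)
    have h2 : DifferentiableAt ℝ (fun ξ : ℂ => quadDisc z v a (r * ξ)) ζ := by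
      unfold quadDisc
      fun_prop
    exact h1.comp ζ h2
  have hpolar : ∀ ζ ∈ ball (0 : ℂ) 1, ∃ η : ℂ, ‖η‖ = 1 ∧ ζ = ‖ζ‖ * η ∧ r * ‖ζ‖ ∈ Ico 0 r := by
    intro ζ hζ
    have hζ1 : ‖ζ‖ < 1 := by simpa using hζ
    exact ⟨Complex.exp (ζ.arg * I), Complex.norm_exp_ofReal_mul_I _,
      (Complex.norm_mul_exp_arg_mul_I ζ).symm, by positivity, mul_lt_of_lt_one_right hr hζ1⟩
  refine sublevel_component_of_radial_growth (R := 1 / 2) (by norm_num)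
    (fun ζ hζ => (hdiff ζ hζ).continuousAt.continuousWithinAt) (by simpa [quadDisc] using hz)
    ?_ ?_ ?_
  · intro ζ hζ t ht
    obtain ⟨η, hη, hζη, hmem⟩ := hpolar ζ hζ
    have hle : t * (r * ‖ζ‖) ≤ r * ‖ζ‖ := mul_le_of_le_one_left hmem.1 ht.2
    have h := (hgrowth η hη).2.1 ⟨mul_nonneg ht.1 hmem.1, hle.trans_lt hmem.2⟩ hmem hle
    dsimp only at h ⊢
    have h1 : (r : ℂ) * ζ = ((r * ‖ζ‖ : ℝ) : ℂ) * η := by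
      conv_lhs => rw [hζη]
      push_cast
      ring
    have h2 : (r : ℂ) * t • ζ = ((t * (r * ‖ζ‖) : ℝ) : ℂ) * η := by
      rw [mul_smul_comm, h1, Complex.real_smul]
      push_cast
      ring
    rwa [h1, h2]
  · intro ζ hζ hneg
    obtain ⟨η, hη, hζη, hmem⟩ := hpolar ζ hζ
    have h := (hgrowth η hη).2.2 _ hmem
    rw [show ((r * ‖ζ‖ : ℝ) : ℂ) * η = r * ζ by
      conv_rhs => rw [hζη]
      push_cast
      ring] at h
    have h2 : r ^ 3 * ‖ζ‖ ^ 2 < r ^ 3 * (1 / 2) ^ 2 := by nlinarith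
    have h3 : ‖ζ‖ ^ 2 < (1 / 2) ^ 2 := lt_of_mul_lt_mul_left h2 (by positivity)
    exact (lt_of_pow_lt_pow_left₀ 2 (by norm_num) h3).le
  · intro ζ hζ hζ0 hzero
    obtain ⟨η, hη, hζη, hmem⟩ := hpolar ζ hζ
    obtain ⟨hder, hpos⟩ := (hgrowth η hη).1 _ hmem
    have hlin : HasDerivAt (fun t : ℝ => (t : ℂ) * (η / r)) (η / r) (r * ‖ζ‖) := by
      simpa using (Complex.ofRealCLM.hasDerivAt (x := r * ‖ζ‖)).mul_const (η / r)
    have hr' : (r : ℂ) ≠ 0 := by exact_mod_cast hr.ne'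
    have hpt : ((r * ‖ζ‖ : ℝ) : ℂ) * (η / r) = ζ := by
      conv_rhs => rw [hζη]
      push_cast
      field_simp
    have hF := (hdiff ζ hζ).hasFDerivAt
    rw [hzero] at hF
    rw [← hpt] at hF
    have hcomp := HasFDerivAt.comp_hasDerivAt (f := fun t : ℝ => (t : ℂ) * (η / r)) _ hF hlin
    have heq : (fun ξ : ℂ => ρ (quadDisc z v a (r * ξ))) ∘ (fun t : ℝ => (t : ℂ) * (η / r)) =
        fun t : ℝ => ρ (quadDisc z v a (t * η)) := by
      funext t
      simp only [Function.comp_apply]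
      congr 2
      field_simp
    rw [heq] at hcomp
    have := hder.unique hcomp
    rw [this] at hpos
    have : 0 < r * (r * ‖ζ‖) := by positivity
    simp at hpos
    linarith

end TangentDiscs

/-- The family of embedded holomorphic discs of Lemma 2: near `bΩ` there are embedded
holomorphic discs `g_{z,v} : 𝔻 → ℂⁿ` centred at `z` tangent to `v ∈ ker ∂ρ(z)`, whose
component through the centre meets `{ρ = 0}` transversely, depending continuously on
`(z, v, ζ)`. -/
theorem family_of_transverse_holomorphic_discs (n : ℕ) (hn : 2 ≤ n)
    (Ω U₀ : Set (EuclideanSpace ℂ (Fin n))) (ρ : EuclideanSpace ℂ (Fin n) → ℝ)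
    (hΩbd : IsBounded Ω) (hU₀open : IsOpen U₀) (hΩU : closure Ω ⊆ U₀)
    (hρC : ContDiffOn ℝ 4 ρ U₀)
    (hpsh : ∀ z ∈ U₀, ∀ w : EuclideanSpace ℂ (Fin n), w ≠ 0 → 0 < levi ρ z w)
    (hΩdef : Ω = {z ∈ U₀ | ρ z < 0})
    (hDρ : ∀ z ∈ frontier Ω, fderiv ℝ ρ z ≠ 0) :
    ∃ (U : Set (EuclideanSpace ℂ (Fin n))) (c : ℝ)
      (g : EuclideanSpace ℂ (Fin n) → EuclideanSpace ℂ (Fin n) → ℂ → EuclideanSpace ℂ (Fin n)),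
      IsOpen U ∧ frontier Ω ⊆ U ∧ U ⊆ U₀ ∧ 0 < c ∧
      (∀ z ∈ U ∩ Ω, ∀ v : EuclideanSpace ℂ (Fin n), ‖v‖ = 1 → cdiff ρ z v = 0 →
        -- g z v is an injective holomorphic map 𝔻 → U₀, an immersion,
        -- with g z v 0 = z and (g z v)′(0) = c • v
        Set.InjOn (g z v) (ball 0 1) ∧
        DifferentiableOn ℂ (g z v) (ball 0 1) ∧
        Set.MapsTo (g z v) (ball 0 1) U₀ ∧
        g z v 0 = z ∧
        deriv (g z v) 0 = c • v ∧
        (∀ ζ ∈ ball (0:ℂ) 1, deriv (g z v) ζ ≠ 0) ∧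
        -- the component D of {ρ ∘ g z v < 0} through 0 is compactly contained in 𝔻,
        -- and g z v meets {ρ = 0} transversely along the frontier of D
        (IsCompact (closure (connectedComponentIn {ζ ∈ ball (0:ℂ) 1 | ρ (g z v ζ) < 0} 0)) ∧
         closure (connectedComponentIn {ζ ∈ ball (0:ℂ) 1 | ρ (g z v ζ) < 0} 0) ⊆ ball 0 1 ∧
         ∀ ζ ∈ frontier (connectedComponentIn {ζ ∈ ball (0:ℂ) 1 | ρ (g z v ζ) < 0} 0),
           ρ (g z v ζ) = 0 ∧ fderiv ℝ (fun ξ => ρ (g z v ξ)) ζ ≠ 0)) ∧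
      -- joint continuity in (z, v, ζ)
      ContinuousOn (fun p : (EuclideanSpace ℂ (Fin n) × EuclideanSpace ℂ (Fin n)) × ℂ =>
          g p.1.1 p.1.2 p.2)
        {p : (EuclideanSpace ℂ (Fin n) × EuclideanSpace ℂ (Fin n)) × ℂ |
          p.1.1 ∈ U ∩ Ω ∧ ‖p.1.2‖ = 1 ∧ cdiff ρ p.1.1 p.1.2 = 0 ∧ p.2 ∈ ball 0 1} := by
  have hρ2 : ContDiffOn ℝ 2 ρ U₀ := hρC.of_le (by norm_num)
  have hρc : ContinuousOn ρ U₀ := hρC.continuousOn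
  have hΩo : IsOpen Ω := by
    rw [hΩdef]
    exact hρc.isOpen_inter_preimage hU₀open isOpen_Iio
  have hfrU : frontier Ω ⊆ U₀ := frontier_subset_closure.trans hΩU
  have hfr0 : ∀ z ∈ frontier Ω, 0 ≤ ρ z := by
    intro z hz
    by_contra! hneg
    rw [hΩo.frontier_eq] at hz
    exact hz.2 (hΩdef ▸ ⟨hΩU hz.1, hneg⟩)
  have hfrc : IsCompact (frontier Ω) :=
    (hΩbd.isCompact_closure).of_isClosed_subset isClosed_frontier frontier_subset_closure
  have hVo : IsOpen (U₀ ∩ fderiv ℝ ρ ⁻¹' {0}ᶜ) :=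
    (hρC.continuousOn_fderiv_of_isOpen hU₀open (by norm_num)).isOpen_inter_preimage hU₀open
      isOpen_compl_singleton
  obtain ⟨K, hK, hfrK, hKV⟩ := exists_compact_between hfrc hVo
    fun z hz => ⟨hfrU hz, hDρ z hz⟩
  obtain ⟨r, hr, hdisc⟩ := exists_uniform_raySecondDeriv_gt hU₀open hρ2 hpsh hK
    (fun z hz => (hKV hz).1) (fun z hz => (hKV hz).2)
  refine ⟨interior K ∩ (U₀ ∩ ρ ⁻¹' Ioi (-(r ^ 3 / 8))), r,
    fun z v ζ => quadDisc z v (discCorrection ρ z v) (r * ζ),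
    isOpen_interior.inter (hρc.isOpen_inter_preimage hU₀open isOpen_Ioi),
    fun z hz => ⟨hfrK hz, hfrU hz, ?_⟩, fun z hz => hz.2.1, hr, ?_, ?_⟩
  · have : 0 < r ^ 3 / 8 := by positivity
    exact (neg_neg_of_pos this).trans_le (hfr0 z hz)
  · rintro z ⟨⟨hzK, hzU, hzr⟩, hzΩ⟩ v hv hcv
    have hzneg : ρ z < 0 := by
      rw [hΩdef] at hzΩ
      exact hzΩ.2
    have hv0 : v ≠ 0 := by
      rintro rfl
      simp at hv
    have hr0 : (r : ℂ) ≠ 0 := by exact_mod_cast hr.ne'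
    have hzdisc := hdisc z (interior_subset hzK) v hv
    have hva := inner_discCorrection_eq_zero hcv
    have hderiv : ∀ ζ : ℂ, HasDerivAt
        (fun ζ : ℂ => quadDisc z v (discCorrection ρ z v) (r * ζ))
        ((r : ℂ) • deriv (quadDisc z v (discCorrection ρ z v)) (r * ζ)) ζ := fun ζ => by
      have h1 : HasDerivAt (fun ζ : ℂ => (r : ℂ) * ζ) r ζ := by
        simpa using (hasDerivAt_id ζ).const_mul (r : ℂ)
      exact (hasDerivAt_quadDisc z v _ (r * ζ)).differentiableAt.hasDerivAt.scomp ζ h1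
    refine ⟨fun ζ _ ζ' _ h => mul_left_cancel₀ hr0 (injective_quadDisc hv0 hva h),
      fun ζ _ => (hderiv ζ).differentiableAt.differentiableWithinAt, fun ζ hζ => ?_,
      by simp [quadDisc], ?_, fun ζ _ => ?_, ?_⟩
    · refine (hzdisc 1 (by simp) (r * ζ) ?_).1
      rw [norm_mul, Complex.norm_real, Real.norm_of_nonneg hr.le]
      exact mul_lt_of_lt_one_right hr (by simpa using hζ)
    · rw [(hderiv 0).deriv, (hasDerivAt_quadDisc z v _ _).deriv]
      simp
    · rw [(hderiv ζ).deriv]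
      exact smul_ne_zero hr0 (deriv_quadDisc_ne_zero hv0 hva _)
    · refine sublevel_component_quadDisc hr hU₀open hρ2 (fun η => ?_) hzdisc hzneg hzr
      rw [fderiv_eq_re_inner_complexGradient, inner_smul_right, inner_complexGradient_eq_zero hcv]
      simp
  · rintro ⟨⟨z, v⟩, ζ⟩ ⟨⟨⟨hzK, hzU, -⟩, -⟩, -⟩
    have ha : ContinuousAt (fun p : (EuclideanSpace ℂ (Fin n) × EuclideanSpace ℂ (Fin n)) × ℂ =>
        discCorrection ρ p.1.1 p.1.2) ((z, v), ζ) :=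
      ContinuousAt.comp
        (g := fun p : EuclideanSpace ℂ (Fin n) × EuclideanSpace ℂ (Fin n) =>
          discCorrection ρ p.1 p.2)
        (continuousAt_discCorrection (hρ2.contDiffAt (hU₀open.mem_nhds hzU))
          (hKV (interior_subset hzK)).2) continuousAt_fst
    refine ContinuousAt.continuousWithinAt ?_
    unfold quadDisc
    fun_prop
end

section
/- Let U ⊆ ℂⁿ be open, let ρ : U → ℝ be of class C², and let z ∈ U. Then for every ε > 0 there is δ > 0 such that for every w ∈ ℂⁿ with |w| ≤ δ and 2·∂ρ(z)(w) + Q_ρ(z)(w) = 0, one has z + w ∈ U and |ρ(z+w) − ρ(z) − L_ρ(z,w)| ≤ ε·|w|². (That is, along the quadratic complex hypersurface Σ_z = {w : 2∂ρ(z)w + Q_ρ(z)(w) = 0}, the increment of ρ equals the Levi form up to o(|w|²).) -/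
open Complex Metric Set Bornology

/-- The holomorphic quadratic part
`Q_ρ(z)(w) = (1/4)(D²ρ(z)(w,w) − D²ρ(z)(iw,iw)) − (i/2) D²ρ(z)(w,iw)`. -/
noncomputable def Qpart {E : Type*} [NormedAddCommGroup E] [NormedSpace ℂ E]
    (ρ : E → ℝ) (z w : E) : ℂ :=
  (((1/4 : ℝ) * (D2 ρ z w w - D2 ρ z (Complex.I • w) (Complex.I • w)) : ℝ) : ℂ)
    - (Complex.I / 2) * ((D2 ρ z w (Complex.I • w) : ℝ) : ℂ)

/-- Second-order Taylor expansion with Peano remainder for a real `C²` function. -/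
theorem ContDiffAt.exists_forall_abs_sub_taylor_two_le {E : Type*} [NormedAddCommGroup E]
    [NormedSpace ℝ E] {f : E → ℝ} {x : E} (hf : ContDiffAt ℝ 2 f x) {ε : ℝ} (hε : 0 < ε) :
    ∃ δ : ℝ, 0 < δ ∧ ∀ w : E, ‖w‖ ≤ δ →
      |f (x + w) - f x - (fderiv ℝ f x w + 1 / 2 * D2 f x w w)| ≤ ε * ‖w‖ ^ 2 := by
  have hsymm : IsSymmSndFDerivAt ℝ f x := hf.isSymmSndFDerivAt (by simp)
  have hd : HasFDerivAt (fderiv ℝ f) (fderiv ℝ (fderiv ℝ f) x) x :=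
    ((hf.fderiv_right (m := 1) (by norm_num)).differentiableAt (by norm_num)).hasFDerivAt
  have hdiff : ∀ᶠ y in nhds x, DifferentiableAt ℝ f y :=
    (hf.eventually (by simp)).mono fun y hy => hy.differentiableAt (by norm_num)
  have hrem := hd.isLittleO.bound hε
  obtain ⟨r, hr, hball⟩ := Metric.eventually_nhds_iff.1 (hdiff.and hrem)
  refine ⟨r / 2, half_pos hr, fun w hw => ?_⟩
  set B := fderiv ℝ (fderiv ℝ f) x
  have hderiv : ∀ v ∈ closedBall (0 : E) ‖w‖,
      HasFDerivWithinAt (fun v => f (x + v) - (fderiv ℝ f x v + 1 / 2 * B v v))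
        (fderiv ℝ f (x + v) - (fderiv ℝ f x + B v)) (closedBall (0 : E) ‖w‖) v := by
    intro v hv
    have hv' : x + v ∈ ball x r := by
      rw [mem_closedBall_zero_iff] at hv
      simp only [mem_ball, dist_self_add_left]
      linarith
    have h₁ : HasFDerivAt (fun v => f (x + v)) (fderiv ℝ f (x + v)) v :=
      (hasFDerivAt_comp_add_left x).2 (hball hv').1.hasFDerivAt
    have h₂ : HasFDerivAt (fun v => B v v) _ v := B.hasFDerivAt.clm_apply (hasFDerivAt_id v)
    refine ((h₁.sub ((fderiv ℝ f x).hasFDerivAt.add (h₂.const_mul (1 / 2)))).congr_fderiv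
      ?_).hasFDerivWithinAt
    ext u
    have hs : B u v = B v u := hsymm u v
    simp [hs]
    ring
  have hbound : ∀ v ∈ closedBall (0 : E) ‖w‖,
      ‖fderiv ℝ f (x + v) - (fderiv ℝ f x + B v)‖ ≤ ε * ‖w‖ := by
    intro v hv
    rw [mem_closedBall_zero_iff] at hv
    have h := (hball (show x + v ∈ ball x r by simp only [mem_ball, dist_self_add_left]; linarith)).2
    rw [add_sub_cancel_left, sub_sub] at h
    exact h.trans (by gcongr)
  have hmv := (convex_closedBall (0 : E) ‖w‖).norm_image_sub_le_of_norm_hasFDerivWithin_le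
    hderiv hbound (mem_closedBall_self (norm_nonneg w)) (y := w) (by simp)
  simp only [add_zero, map_zero, mul_zero, sub_zero, Real.norm_eq_abs] at hmv
  have hD : D2 f x w w = B w w := rfl
  rw [hD]
  calc _ = _ := by congr 1; ring
    _ ≤ _ := hmv
    _ = _ := by ring

/-- The real part of `2 ∂ρ(z)(w) + Q_ρ(z)(w)` is the second-order Taylor increment of `ρ` minus
its Levi form. -/
theorem re_two_mul_cdiff_add_Qpart {E : Type*} [NormedAddCommGroup E] [NormedSpace ℂ E]
    (ρ : E → ℝ) (z w : E) :
    (2 * cdiff ρ z w + Qpart ρ z w).re =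
      fderiv ℝ ρ z w + 1 / 2 * D2 ρ z w w - levi ρ z w := by
  have h : (2 * cdiff ρ z w + Qpart ρ z w).re =
      fderiv ℝ ρ z w + 1 / 4 * (D2 ρ z w w - D2 ρ z (Complex.I • w) (Complex.I • w)) := by
    simp [cdiff, Qpart]
  rw [h, levi]
  ring

/-- Along the quadratic complex hypersurface `Σ_z = {w : 2∂ρ(z)(w) + Q_ρ(z)(w) = 0}`, the
increment of a `C²` function `ρ` equals its Levi form up to `o(|w|²)`. -/
theorem increment_eq_levi_on_Sigma (n : ℕ)
    (U : Set (EuclideanSpace ℂ (Fin n))) (hUopen : IsOpen U)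
    (ρ : EuclideanSpace ℂ (Fin n) → ℝ) (hρC : ContDiffOn ℝ 2 ρ U)
    (z : EuclideanSpace ℂ (Fin n)) (hz : z ∈ U) :
    ∀ ε : ℝ, 0 < ε → ∃ δ : ℝ, 0 < δ ∧
      ∀ w : EuclideanSpace ℂ (Fin n), ‖w‖ ≤ δ →
        2 * cdiff ρ z w + Qpart ρ z w = 0 →
        z + w ∈ U ∧ |ρ (z + w) - ρ z - levi ρ z w| ≤ ε * ‖w‖ ^ 2 := by
  intro ε hε
  obtain ⟨δ, hδ, htaylor⟩ :=
    (hρC.contDiffAt (hUopen.mem_nhds hz)).exists_forall_abs_sub_taylor_two_le hε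
  obtain ⟨r, hr, hball⟩ := Metric.isOpen_iff.1 hUopen z hz
  refine ⟨min δ (r / 2), lt_min hδ (half_pos hr), fun w hw hw0 => ⟨hball ?_, ?_⟩⟩
  · have := hw.trans (min_le_right _ _)
    simp only [mem_ball, dist_self_add_left]
    linarith
  · have hre := re_two_mul_cdiff_add_Qpart ρ z w
    rw [hw0, Complex.zero_re] at hre
    rw [← sub_eq_zero.1 hre.symm]
    exact htaylor w (hw.trans (min_le_left _ _))
end

section
/- Let U ⊆ ℂⁿ be open, let ρ : U → ℝ be of class C², let z ∈ U, and suppose there is C > 0 with L_ρ(z,w) ≥ C·|w|² for all w ∈ ℂⁿ. Then there exists δ > 0 such that for every w ∈ ℂⁿ with |w| ≤ δ and 2·∂ρ(z)(w) + Q_ρ(z)(w) = 0, one has z + w ∈ U and ρ(z+w) ≥ ρ(z) + (C/2)·|w|². In particular, if additionally ρ(z+w) ≤ 0, then |w|² ≤ −2ρ(z)/C. -/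
open Complex Metric Set Bornology

/-- Second-order Taylor estimate at a point where the derivative is itself differentiable. -/
theorem exists_second_order_taylor_bound {E : Type*} [NormedAddCommGroup E] [NormedSpace ℝ E]
    {U : Set E} (hU : IsOpen U) {ρ : E → ℝ} (hρ : ContDiffOn ℝ 2 ρ U) {z : E} (hz : z ∈ U)
    {ε : ℝ} (hε : 0 < ε) :
    ∃ δ : ℝ, 0 < δ ∧ ∀ w : E, ‖w‖ ≤ δ → z + w ∈ U ∧
      |ρ (z + w) - ρ z - fderiv ℝ ρ z w - (1 / 2) * D2 ρ z w w| ≤ ε * ‖w‖ ^ 2 := by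
  have hfderiv : HasFDerivAt (fderiv ℝ ρ) (fderiv ℝ (fderiv ℝ ρ) z) z :=
    (((hρ.contDiffAt (hU.mem_nhds hz)).fderiv_right (m := 1) (by norm_num)).differentiableAt
      (by norm_num)).hasFDerivAt
  have hev := (hfderiv.isLittleO.def hε).and (hU.mem_nhds hz)
  obtain ⟨δ, hδ, hball⟩ := Metric.nhds_basis_closedBall.eventually_iff.1 hev
  have hmem : ∀ v : E, ‖v‖ ≤ δ → z + v ∈ closedBall z δ := fun v hv ↦ by simpa using hv
  refine ⟨δ, hδ, fun w hw ↦ ⟨(hball (hmem w hw)).2, ?_⟩⟩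
  have hnorm : ∀ t ∈ Icc (0 : ℝ) 1, ‖t • w‖ ≤ ‖w‖ := fun t ht ↦ by
    rw [norm_smul, Real.norm_of_nonneg ht.1]
    exact mul_le_of_le_one_left (norm_nonneg w) ht.2
  have hderiv : ∀ t ∈ Icc (0 : ℝ) 1, HasDerivWithinAt
      (fun t : ℝ ↦ ρ (z + t • w) - t * fderiv ℝ ρ z w - t ^ 2 * ((1 / 2) * D2 ρ z w w))
      (fderiv ℝ ρ (z + t • w) w - fderiv ℝ ρ z w - t * D2 ρ z w w) (Icc 0 1) t := by
    intro t ht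
    have hρt : HasFDerivAt ρ (fderiv ℝ ρ (z + t • w)) (z + t • w) :=
      ((hρ.contDiffAt (hU.mem_nhds (hball (hmem _ ((hnorm t ht).trans hw))).2)).differentiableAt
        (by norm_num)).hasFDerivAt
    have hline : HasDerivAt (fun t : ℝ ↦ z + t • w) w t := by
      simpa using ((hasDerivAt_id t).smul_const w).const_add z
    have h := ((hρt.comp_hasDerivAt t hline).sub
      ((hasDerivAt_id t).mul_const (fderiv ℝ ρ z w))).sub
      (((hasDerivAt_id t).pow 2).mul_const ((1 / 2) * D2 ρ z w w))
    refine (h.congr_deriv ?_).hasDerivWithinAt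
    simp only [id, Nat.cast_ofNat]
    ring
  have hbound : ∀ t ∈ Ico (0 : ℝ) 1,
      ‖fderiv ℝ ρ (z + t • w) w - fderiv ℝ ρ z w - t * D2 ρ z w w‖ ≤ ε * ‖w‖ ^ 2 := by
    intro t ht
    have hle := hnorm t ⟨ht.1, ht.2.le⟩
    have h := (hball (hmem (t • w) (hle.trans hw))).1
    rw [add_sub_cancel_left] at h
    calc _ = ‖(fderiv ℝ ρ (z + t • w) - fderiv ℝ ρ z - fderiv ℝ (fderiv ℝ ρ) z (t • w)) w‖ := by
            simp [D2]
      _ ≤ ε * ‖t • w‖ * ‖w‖ := ContinuousLinearMap.le_of_opNorm_le _ h w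
      _ ≤ ε * ‖w‖ * ‖w‖ := by gcongr
      _ = ε * ‖w‖ ^ 2 := by ring
  have h := norm_image_sub_le_of_norm_deriv_le_segment_01' hderiv hbound
  rw [Real.norm_eq_abs] at h
  convert h using 2
  simp only [one_smul, zero_smul, add_zero]
  ring

/-- The quadratic Taylor polynomial splits into the real part of its holomorphic part and the
Levi form. -/
theorem re_add_levi {E : Type*} [NormedAddCommGroup E] [NormedSpace ℂ E] (ρ : E → ℝ) (z w : E) :
    (2 * cdiff ρ z w + Qpart ρ z w).re + levi ρ z w =
      fderiv ℝ ρ z w + (1 / 2) * D2 ρ z w w := by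
  have hlin : (2 * cdiff ρ z w).re = fderiv ℝ ρ z w := by
    rw [cdiff, ← mul_assoc, mul_one_div_cancel two_ne_zero, one_mul]
    simp
  have hquad : (Qpart ρ z w).re =
      (1 / 4) * (D2 ρ z w w - D2 ρ z (Complex.I • w) (Complex.I • w)) := by
    rw [Qpart, Complex.sub_re, Complex.ofReal_re, Complex.re_mul_ofReal]
    simp
  rw [Complex.add_re, hlin, hquad, levi]
  ring

/-- If the Levi form of `ρ` at `z` satisfies `L_ρ(z,w) ≥ C|w|²`, then along the quadratic
hypersurface `Σ_z = {w : 2∂ρ(z)(w) + Q_ρ(z)(w) = 0}` the function `ρ` increases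
quadratically: `ρ(z+w) ≥ ρ(z) + (C/2)|w|²` for small `w`; in particular if also
`ρ(z+w) ≤ 0` then `|w|² ≤ −2ρ(z)/C`. -/
theorem quadratic_growth_on_Sigma (n : ℕ)
    (U : Set (EuclideanSpace ℂ (Fin n))) (hUopen : IsOpen U)
    (ρ : EuclideanSpace ℂ (Fin n) → ℝ) (hρC : ContDiffOn ℝ 2 ρ U)
    (z : EuclideanSpace ℂ (Fin n)) (hz : z ∈ U)
    (C : ℝ) (hC : 0 < C)
    (hlevi : ∀ w : EuclideanSpace ℂ (Fin n), C * ‖w‖ ^ 2 ≤ levi ρ z w) :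
    ∃ δ : ℝ, 0 < δ ∧
      ∀ w : EuclideanSpace ℂ (Fin n), ‖w‖ ≤ δ →
        2 * cdiff ρ z w + Qpart ρ z w = 0 →
        z + w ∈ U ∧ ρ z + (C/2) * ‖w‖ ^ 2 ≤ ρ (z + w) ∧
          (ρ (z + w) ≤ 0 → ‖w‖ ^ 2 ≤ -2 * ρ z / C) := by
  obtain ⟨δ, hδ, htaylor⟩ := exists_second_order_taylor_bound hUopen hρC hz (half_pos hC)
  refine ⟨δ, hδ, fun w hw hw_zero ↦ ?_⟩
  obtain ⟨hwU, hest⟩ := htaylor w hw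
  have hre := re_add_levi ρ z w
  rw [hw_zero, Complex.zero_re] at hre
  have hgrowth : ρ z + (C / 2) * ‖w‖ ^ 2 ≤ ρ (z + w) := by
    linarith [(abs_le.1 hest).1, hlevi w]
  refine ⟨hwU, hgrowth, fun hneg ↦ ?_⟩
  rw [le_div_iff₀ hC]
  linarith
end

section
/- Let U ⊆ ℂⁿ be open, ρ : U → ℝ of class C², let D ⊆ ℂ be open, and let f : D → ℂⁿ be holomorphic with f(D) ⊆ U. Then the composition u = ρ∘f : D → ℝ is twice real-differentiable on D and for every ζ ∈ D its Laplacian satisfies Δu(ζ) = 4·L_ρ( f(ζ), f′(ζ) ). In particular, if L_ρ(z,w) ≥ 0 for all z ∈ U and w ∈ ℂⁿ, then Δ(ρ∘f) ≥ 0 on D (ρ∘f is subharmonic). -/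
open Complex Metric Set Bornology

/-- The Laplacian `Δu(ζ) = D²u(ζ)(1,1) + D²u(ζ)(i,i)` of a function `u : ℂ → ℝ`. -/
noncomputable def lap (u : ℂ → ℝ) (ζ : ℂ) : ℝ :=
  D2 u ζ 1 1 + D2 u ζ Complex.I Complex.I

/-- The second derivative of `ρ ∘ f`, for `f` holomorphic, evaluated at `(v, v)`. -/
theorem D2_comp_holomorphic {E : Type*} [NormedAddCommGroup E] [NormedSpace ℂ E]
    {ρ : E → ℝ} {f : ℂ → E} {ζ : ℂ}
    (hρ : ContDiffAt ℝ 2 ρ (f ζ)) (hf : ContDiffAt ℂ 2 f ζ) (v : ℂ) :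
    D2 (fun ξ => ρ (f ξ)) ζ v v =
      D2 ρ (f ζ) (v • deriv f ζ) (v • deriv f ζ)
        + fderiv ℝ ρ (f ζ) ((v * v) • deriv (deriv f) ζ) := by
  have hfr : ∀ ξ, DifferentiableAt ℂ f ξ → HasFDerivAt f
      ((ContinuousLinearMap.toSpanSingleton ℂ (deriv f ξ)).restrictScalars ℝ) ξ :=
    fun ξ h => h.hasDerivAt.hasFDerivAt.restrictScalars ℝ
  have hfζ : DifferentiableAt ℂ f ζ := hf.differentiableAt (by norm_num)
  have hf'ζ : DifferentiableAt ℂ (deriv f) ζ := by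
    have h : DifferentiableAt ℂ (fderiv ℂ f) ζ :=
      (hf.fderiv_right (m := 1) (by norm_num)).differentiableAt (by norm_num)
    exact h.clm_apply (differentiableAt_const (1 : ℂ))
  have hρ' : DifferentiableAt ℝ (fderiv ℝ ρ) (f ζ) :=
    (hρ.fderiv_right (m := 1) (by norm_num)).differentiableAt (by norm_num)
  have hu' : DifferentiableAt ℝ (fderiv ℝ (fun ξ => ρ (f ξ))) ζ :=
    ((hρ.comp ζ (hf.restrict_scalars ℝ)).fderiv_right (m := 1)
      (by norm_num)).differentiableAt (by norm_num)
  have hchain : (fun ξ => fderiv ℝ (fun ξ => ρ (f ξ)) ξ v)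
      =ᶠ[nhds ζ] fun ξ => fderiv ℝ ρ (f ξ) (v • deriv f ξ) := by
    filter_upwards [hf.eventually (by simp),
      hfζ.continuousAt.eventually (hρ.eventually (by simp))] with ξ hξ hρξ
    have h := (hρξ.differentiableAt (by norm_num)).hasFDerivAt.comp ξ
      (hfr ξ (hξ.differentiableAt (by norm_num)))
    have h' : fderiv ℝ (fun ξ => ρ (f ξ)) ξ = _ := h.fderiv
    rw [h']
    simp
  have hw : HasFDerivAt (fun ξ => v • deriv f ξ)
      ((ContinuousLinearMap.toSpanSingleton ℂ
        (v • deriv (deriv f) ζ)).restrictScalars ℝ) ζ :=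
    (hf'ζ.hasDerivAt.const_smul v).hasFDerivAt.restrictScalars ℝ
  have hR := (hρ'.hasFDerivAt.comp ζ (hfr ζ hfζ)).clm_apply hw
  have hL := hu'.hasFDerivAt.clm_apply (hasFDerivAt_const v ζ)
  have key := congrArg (fun T : ℂ →L[ℝ] ℝ => T v)
    (hL.unique (hR.congr_of_eventuallyEq hchain))
  simp [smul_smul] at key
  simp only [D2]
  rw [key, add_comm]

/-- If `ρ` is `C²` on `U ⊆ ℂⁿ` and `f : D → U` is holomorphic on an open set `D ⊆ ℂ`, then
`u = ρ ∘ f` is twice real-differentiable on `D` with `Δu(ζ) = 4·L_ρ(f(ζ), f′(ζ))`; in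
particular, if `L_ρ ≥ 0` everywhere then `ρ ∘ f` is subharmonic (`Δ(ρ∘f) ≥ 0`). -/
theorem laplacian_comp_holomorphic_eq_levi (n : ℕ)
    (U : Set (EuclideanSpace ℂ (Fin n))) (hUopen : IsOpen U)
    (ρ : EuclideanSpace ℂ (Fin n) → ℝ) (hρC : ContDiffOn ℝ 2 ρ U)
    (D : Set ℂ) (hDopen : IsOpen D)
    (f : ℂ → EuclideanSpace ℂ (Fin n)) (hf : DifferentiableOn ℂ f D)
    (hfU : Set.MapsTo f D U) :
    (∀ ζ ∈ D,
      DifferentiableAt ℝ (fun ξ => ρ (f ξ)) ζ ∧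
      DifferentiableAt ℝ (fderiv ℝ (fun ξ => ρ (f ξ))) ζ ∧
      lap (fun ξ => ρ (f ξ)) ζ = 4 * levi ρ (f ζ) (deriv f ζ)) ∧
    ((∀ z ∈ U, ∀ w : EuclideanSpace ℂ (Fin n), 0 ≤ levi ρ z w) →
      ∀ ζ ∈ D, 0 ≤ lap (fun ξ => ρ (f ξ)) ζ) := by
  have hρ : ∀ ζ ∈ D, ContDiffAt ℝ 2 ρ (f ζ) := fun ζ hζ =>
    hρC.contDiffAt (hUopen.mem_nhds (hfU hζ))
  have hf2 : ∀ ζ ∈ D, ContDiffAt ℂ 2 f ζ := fun ζ hζ =>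
    (hf.contDiffOn hDopen).contDiffAt (hDopen.mem_nhds hζ)
  have hlap : ∀ ζ ∈ D, lap (fun ξ => ρ (f ξ)) ζ = 4 * levi ρ (f ζ) (deriv f ζ) := by
    intro ζ hζ
    rw [lap, D2_comp_holomorphic (hρ ζ hζ) (hf2 ζ hζ), D2_comp_holomorphic (hρ ζ hζ) (hf2 ζ hζ),
      levi, Complex.I_mul_I, neg_smul, map_neg, one_smul, one_mul, one_smul]
    ring
  refine ⟨fun ζ hζ => ?_, fun hpos ζ hζ => ?_⟩
  · have hu : ContDiffAt ℝ 2 (fun ξ => ρ (f ξ)) ζ :=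
      (hρ ζ hζ).comp ζ ((hf2 ζ hζ).restrict_scalars ℝ)
    exact ⟨hu.differentiableAt (by norm_num),
      (hu.fderiv_right (m := 1) (by norm_num)).differentiableAt (by norm_num), hlap ζ hζ⟩
  · rw [hlap ζ hζ]
    exact mul_nonneg (by norm_num) (hpos _ (hfU hζ) _)
end

section
/- Let U ⊆ ℂⁿ be open and let ρ : U → ℝ be of class C² with L_ρ(z,w) ≥ 0 for all z ∈ U and w ∈ ℂⁿ (ρ is plurisubharmonic). Let f : ℂ → ℂⁿ be continuous on the closed unit disc closure(𝔻), holomorphic on 𝔻, with f(closure(𝔻)) ⊆ U. If ρ(f(ζ)) ≤ 0 for every ζ with |ζ| = 1, then ρ(f(ζ)) ≤ 0 for every ζ ∈ closure(𝔻). -/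
open Complex Metric Set Bornology

/-- Second derivative test: at a local maximum the second derivative is nonpositive. -/
theorem IsLocalMax.second_hasDerivAt_nonpos {h h' : ℝ → ℝ} {a c : ℝ} (hmax : IsLocalMax h a)
    (hh : ∀ᶠ t in nhds a, HasDerivAt h (h' t) t) (hh' : HasDerivAt h' c a) : c ≤ 0 := by
  by_contra! hc
  have hderiv : deriv h =ᶠ[nhds a] h' := hh.mono fun t ht => ht.deriv
  have hderiv2 : deriv (deriv h) a = c := by rw [hderiv.deriv_eq, hh'.deriv]
  have hmin : IsLocalMin h a := isLocalMin_of_deriv_deriv_pos (by rwa [hderiv2])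
    hmax.deriv_eq_zero hh.self_of_nhds.continuousAt
  have hconst : h =ᶠ[nhds a] fun _ => h a := by
    filter_upwards [hmax, hmin] with t h1 h2 using le_antisymm h1 h2
  have hzero : deriv h =ᶠ[nhds a] fun _ => 0 := by
    filter_upwards [hconst.deriv] with t ht
    simpa using ht
  have : deriv (deriv h) a = 0 := by simpa using hzero.deriv_eq
  linarith

/-- If `ρ ∘ f + ε ‖·‖²`, with `f` holomorphic near `z`, has a local maximum at `z`, then its second
derivative at `z` in every real direction `v` is nonpositive. -/
theorem D2_comp_add_le_of_isLocalMax {E : Type*} [NormedAddCommGroup E] [NormedSpace ℂ E]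
    [CompleteSpace E] {ρ : E → ℝ} {f : ℂ → E} {z : ℂ} {ε : ℝ} (hρ : ContDiffAt ℝ 2 ρ (f z))
    (hf : AnalyticAt ℂ f z) (hmax : IsLocalMax (fun ζ => ρ (f ζ) + ε * ‖ζ‖ ^ 2) z) (v : ℂ) :
    D2 ρ (f z) (v • deriv f z) (v • deriv f z)
      + fderiv ℝ ρ (f z) (v ^ 2 • deriv (deriv f) z) + 2 * ε * ‖v‖ ^ 2 ≤ 0 := by
  have hline : ∀ t : ℝ, HasDerivAt (fun t : ℝ => z + t * v) v t := fun t => by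
    simpa using ((hasDerivAt_id t).ofReal_comp.mul_const v).const_add z
  have hz : z + ((0 : ℝ) : ℂ) * v = z := by simp
  have htend : Filter.Tendsto (fun t : ℝ => z + t * v) (nhds 0) (nhds z) := by
    simpa only [ContinuousAt, hz] using (hline 0).continuousAt
  have hcomp : ∀ {g : ℂ → E} {t : ℝ}, AnalyticAt ℂ g (z + t * v) →
      HasDerivAt (fun t : ℝ => g (z + t * v)) (v • deriv g (z + t * v)) t := fun {g t} hg =>
    HasDerivAt.scomp (h := fun t : ℝ => z + t * v) t hg.differentiableAt.hasDerivAt (hline t)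
  have hsq : ∀ t : ℝ, HasDerivAt (fun t : ℝ => ε * ‖z + t * v‖ ^ 2)
      (ε * (2 * inner ℝ (z + t * v) v)) t := fun t => (hline t).norm_sq.const_mul ε
  have hsq' : HasDerivAt (fun t : ℝ => ε * (2 * inner ℝ (z + t * v) v)) (2 * ε * ‖v‖ ^ 2) 0 := by
    have := (((hline 0).inner ℝ (hasDerivAt_const (0 : ℝ) v)).const_mul 2).const_mul ε
    rw [inner_zero_right, real_inner_self_eq_norm_sq, zero_add, ← mul_assoc, mul_comm ε] at this
    exact this
  have hρ' : HasFDerivAt (fderiv ℝ ρ) (fderiv ℝ (fderiv ℝ ρ) (f z)) (f z) :=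
    ((hρ.fderiv_right (m := 1) (by norm_num)).differentiableAt (by norm_num)).hasFDerivAt
  have hρd : ∀ᶠ w in nhds (f z), DifferentiableAt ℝ ρ w :=
    (hρ.eventually (by simp)).mono fun w hw => hw.differentiableAt (by norm_num)
  have hfirst : ∀ᶠ t : ℝ in nhds 0, HasDerivAt (fun t : ℝ => ρ (f (z + t * v)) + ε * ‖z + t * v‖ ^ 2)
      (fderiv ℝ ρ (f (z + t * v)) (v • deriv f (z + t * v))
        + ε * (2 * inner ℝ (z + t * v) v)) t := by
    filter_upwards [htend.eventually hf.eventually_analyticAt,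
      htend.eventually (hf.continuousAt.eventually hρd)] with t h1 h2
    exact (h2.hasFDerivAt.comp_hasDerivAt t (hcomp h1)).add (hsq t)
  have hsecond : HasDerivAt (fun t : ℝ => fderiv ℝ ρ (f (z + t * v)) (v • deriv f (z + t * v))
        + ε * (2 * inner ℝ (z + t * v) v))
      (D2 ρ (f z) (v • deriv f z) (v • deriv f z)
        + fderiv ℝ ρ (f z) (v ^ 2 • deriv (deriv f) z) + 2 * ε * ‖v‖ ^ 2) 0 := by
    have h1 := hcomp (t := 0) (by rwa [hz])
    have h2 := (hcomp (t := 0) (by rw [hz]; exact hf.deriv)).const_smul v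
    have h3 := HasFDerivAt.comp_hasDerivAt (0 : ℝ) (by rwa [hz]) h1 (l := fderiv ℝ ρ)
    have h4 := (h3.clm_apply h2).add hsq'
    simpa only [hz, Function.comp_apply, Pi.add_def, Pi.smul_apply, D2, smul_smul, ← pow_two] using h4
  have hmax' : IsLocalMax (fun t : ℝ => ρ (f (z + t * v)) + ε * ‖z + t * v‖ ^ 2) 0 := by
    have := htend.eventually hmax
    simpa only [IsLocalMax, IsMaxFilter, hz] using this
  exact hmax'.second_hasDerivAt_nonpos hfirst hsecond

/-- Maximum principle: if `ρ` is `C²` and plurisubharmonic on `U` (nonnegative Levi form)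
and `f` is continuous on the closed unit disc, holomorphic in the open disc, with values
in `U`, and `ρ ∘ f ≤ 0` on the unit circle, then `ρ ∘ f ≤ 0` on the closed disc. -/
theorem psh_composition_max_principle (n : ℕ)
    (U : Set (EuclideanSpace ℂ (Fin n))) (hUopen : IsOpen U)
    (ρ : EuclideanSpace ℂ (Fin n) → ℝ) (hρC : ContDiffOn ℝ 2 ρ U)
    (hpsh : ∀ z ∈ U, ∀ w : EuclideanSpace ℂ (Fin n), 0 ≤ levi ρ z w)
    (f : ℂ → EuclideanSpace ℂ (Fin n))
    (hfc : ContinuousOn f (closedBall 0 1))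
    (hfh : DifferentiableOn ℂ f (ball 0 1))
    (hfU : Set.MapsTo f (closedBall 0 1) U)
    (hbd : ∀ ζ : ℂ, ‖ζ‖ = 1 → ρ (f ζ) ≤ 0) :
    ∀ ζ ∈ closedBall (0:ℂ) 1, ρ (f ζ) ≤ 0 := by
  have hpert : ∀ ε > 0, ∀ ζ ∈ closedBall (0 : ℂ) 1, ρ (f ζ) + ε * ‖ζ‖ ^ 2 ≤ ε := by
    intro ε hε
    obtain ⟨z, hz, hzmax⟩ := (isCompact_closedBall (0 : ℂ) 1).exists_isMaxOn
      (nonempty_closedBall.2 zero_le_one) (f := fun ζ => ρ (f ζ) + ε * ‖ζ‖ ^ 2)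
      ((hρC.continuousOn.comp hfc hfU).add (by fun_prop))
    intro ζ hζ
    refine (hzmax hζ).trans ?_
    rcases (mem_closedBall_zero_iff.1 hz).lt_or_eq with hlt | heq
    · exfalso
      have hball : ball (0 : ℂ) 1 ∈ nhds z := isOpen_ball.mem_nhds (mem_ball_zero_iff.2 hlt)
      have hle := D2_comp_add_le_of_isLocalMax (hρC.contDiffAt (hUopen.mem_nhds (hfU hz)))
        (hfh.analyticAt hball)
        (hzmax.isLocalMax (Filter.mem_of_superset hball ball_subset_closedBall))
      have h1 := hle 1
      have hI := hle Complex.I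
      have hL := hpsh (f z) (hfU hz) (deriv f z)
      simp only [levi, one_smul, one_pow, norm_one, Complex.I_sq, neg_smul, map_neg,
        Complex.norm_I] at h1 hI hL
      linarith
    · have := hbd z heq
      simp only [heq]
      linarith
  intro ζ hζ
  refine le_of_forall_pos_le_add fun ε hε => ?_
  have := hpert ε hε ζ hζ
  have : 0 ≤ ε * ‖ζ‖ ^ 2 := by positivity
  linarith
end

section
/- Let U ⊆ ℂⁿ be open and let ρ : U → ℝ be of class C² with L_ρ(z,w) > 0 for all z ∈ U and all w ∈ ℂⁿ \ {0} (ρ is strongly plurisubharmonic). Let f : ℂ → ℂⁿ be continuous on the closed unit disc closure(𝔻), holomorphic and nonconstant on 𝔻, with f(closure(𝔻)) ⊆ U. If ρ(f(ζ)) ≤ 0 for every ζ with |ζ| = 1, then ρ(f(ζ)) < 0 for every ζ ∈ 𝔻. -/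
open Complex Metric Set Bornology

/-- The Levi form scales quadratically under real scalars. -/
theorem levi_real_smul {E : Type*} [NormedAddCommGroup E] [NormedSpace ℂ E]
    (ρ : E → ℝ) (z w : E) (r : ℝ) : levi ρ z (r • w) = r ^ 2 * levi ρ z w := by
  simp only [levi, D2, smul_comm Complex.I r w, map_smul, smul_apply,
    smul_eq_mul]
  ring

theorem exists_pos_mul_norm_sq_le_levi {E : Type*} [NormedAddCommGroup E] [NormedSpace ℂ E]
    [FiniteDimensional ℂ E] {ρ : E → ℝ} {z : E} (h : ∀ w : E, w ≠ 0 → 0 < levi ρ z w) :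
    ∃ c > 0, ∀ w : E, c * ‖w‖ ^ 2 ≤ levi ρ z w := by
  have hcont : Continuous (levi ρ z) := by
    unfold levi D2
    fun_prop
  have : ProperSpace E := FiniteDimensional.proper ℂ E
  rcases (sphere (0 : E) 1).eq_empty_or_nonempty with he | hne
  · refine ⟨1, one_pos, fun w => ?_⟩
    by_cases hw : w = 0
    · simp [hw, levi, D2]
    · have : ‖w‖⁻¹ • w ∈ sphere (0 : E) 1 := by
        simp [norm_smul, hw]
      simp [he] at this
  · obtain ⟨v, hv, hmin⟩ := (isCompact_sphere (0 : E) 1).exists_isMinOn hne hcont.continuousOn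
    have hv0 : v ≠ 0 := by
      rintro rfl
      simp at hv
    refine ⟨levi ρ z v, h v hv0, fun w => ?_⟩
    by_cases hw : w = 0
    · simp [hw, levi, D2]
    · have hmem : ‖w‖⁻¹ • w ∈ sphere (0 : E) 1 := by
        simp [norm_smul, hw]
      have h1 : levi ρ z v ≤ levi ρ z (‖w‖⁻¹ • w) := hmin hmem
      have hpos : 0 < ‖w‖ := norm_pos_iff.2 hw
      rw [levi_real_smul, inv_pow, inv_mul_eq_div, le_div_iff₀ (by positivity)] at h1
      exact h1

/-- Second-order Taylor expansion with a little-o remainder, in `ε`-form. -/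
theorem ContDiffAt.eventually_abs_taylor_two_le {E : Type*} [NormedAddCommGroup E]
    [NormedSpace ℝ E] {ρ : E → ℝ} {z : E} (h : ContDiffAt ℝ 2 ρ z) {ε : ℝ} (hε : 0 < ε) :
    ∀ᶠ w in nhds (0 : E),
      |ρ (z + w) - ρ z - fderiv ℝ ρ z w - (1 / 2) * D2 ρ z w w| ≤ ε * ‖w‖ ^ 2 := by
  have hdiff : ∀ᶠ x in nhds z, DifferentiableAt ℝ ρ x :=
    (h.eventually (by simp)).mono fun x hx => hx.differentiableAt (by simp)
  have hB : HasFDerivAt (fderiv ℝ ρ) (fderiv ℝ (fderiv ℝ ρ) z) z :=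
    ((h.fderiv_right (m := 1) (by norm_num)).differentiableAt (by simp)).hasFDerivAt
  obtain ⟨δ, hδ, hball⟩ := Metric.eventually_nhds_iff_ball.1 (hdiff.and (hB.isLittleO.bound hε))
  filter_upwards [Metric.ball_mem_nhds (0 : E) hδ] with w hw
  have hmem : ∀ t ∈ Icc (0 : ℝ) 1, z + t • w ∈ ball z δ := fun t ht => by
    have : ‖t • w‖ ≤ ‖w‖ := by
      rw [norm_smul, Real.norm_of_nonneg ht.1]
      exact mul_le_of_le_one_left (norm_nonneg w) ht.2
    simp only [mem_ball, dist_self_add_left] at hw ⊢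
    exact this.trans_lt (by simpa using hw)
  have hderiv : ∀ t ∈ Icc (0 : ℝ) 1, HasDerivAt
      (fun t : ℝ => ρ (z + t • w) - t * fderiv ℝ ρ z w - t ^ 2 * ((1 / 2) * D2 ρ z w w))
      ((fderiv ℝ ρ (z + t • w) - fderiv ℝ ρ z - fderiv ℝ (fderiv ℝ ρ) z (t • w)) w) t := by
    intro t ht
    have hline : HasDerivAt (fun t : ℝ => z + t • w) w t := by
      simpa using ((hasDerivAt_id t).smul_const w).const_add z
    have h1 := (hball _ (hmem t ht)).1.hasFDerivAt.comp_hasDerivAt t hline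
    have h2 := (hasDerivAt_id t).mul_const (fderiv ℝ ρ z w)
    have h3 := ((hasDerivAt_id t).pow 2).mul_const ((1 / 2) * D2 ρ z w w)
    refine ((h1.sub h2).sub h3).congr_deriv ?_
    simp [D2]
    ring
  have hle := norm_image_sub_le_of_norm_deriv_le_segment_01' (C := ε * ‖w‖ ^ 2)
    (fun t ht => (hderiv t ht).hasDerivWithinAt) (fun t ht => by
      have ht' := Ico_subset_Icc_self ht
      have hb := (hball _ (hmem t ht')).2
      rw [add_sub_cancel_left] at hb
      have hs : ‖t • w‖ ≤ ‖w‖ := by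
        rw [norm_smul, Real.norm_of_nonneg ht'.1]
        exact mul_le_of_le_one_left (norm_nonneg w) ht'.2
      calc _ ≤ _ * ‖w‖ := ContinuousLinearMap.le_opNorm _ _
        _ ≤ (ε * ‖t • w‖) * ‖w‖ := by gcongr
        _ ≤ (ε * ‖w‖) * ‖w‖ := by gcongr
        _ = ε * ‖w‖ ^ 2 := by ring)
  rw [Real.norm_eq_abs] at hle
  convert hle using 2
  simp
  ring

theorem complex_smul_eq_re_smul_add_im_smul_I {E : Type*} [AddCommGroup E] [Module ℂ E]
    (c : ℂ) (x : E) : c • x = c.re • x + c.im • I • x := by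
  conv_lhs => rw [← Complex.re_add_im c, add_smul, mul_smul, Complex.coe_smul, Complex.coe_smul]

/-- The complex bilinear part of a real bilinear form. -/
noncomputable def complexBilinPart {E : Type*} [NormedAddCommGroup E] [NormedSpace ℂ E]
    (B : E →L[ℝ] E →L[ℝ] ℝ) : E →ₗ[ℂ] E →ₗ[ℂ] ℂ :=
  LinearMap.mk₂ ℂ
    (fun w v => (⟨(B w v - B (I • w) (I • v)) / 2, -(B (I • w) v + B w (I • v)) / 2⟩ : ℂ))
    (fun w w' v => by
      apply Complex.ext <;> simp <;> ring)
    (fun c w v => by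
      have hc := complex_smul_eq_re_smul_add_im_smul_I (E := E) c
      have hI : I • I • w = -w := by simp [smul_smul]
      rw [smul_comm I c w, hc w, hc (I • w), hI]
      apply Complex.ext <;> simp <;> ring)
    (fun w v v' => by
      apply Complex.ext <;> simp <;> ring)
    (fun c w v => by
      have hc := complex_smul_eq_re_smul_add_im_smul_I (E := E) c
      have hI : I • I • v = -v := by simp [smul_smul]
      rw [smul_comm I c v, hc v, hc (I • v), hI]
      apply Complex.ext <;> simp <;> ring)

theorem re_complexBilinPart_self {E : Type*} [NormedAddCommGroup E] [NormedSpace ℂ E]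
    (B : E →L[ℝ] E →L[ℝ] ℝ) (w : E) :
    (complexBilinPart B w w).re = (B w w - B (I • w) (I • w)) / 2 := rfl

/-- Near a point where the Levi form of `ρ` is positive definite, `ρ` is bounded below by the real
part of a holomorphic function plus a positive multiple of the squared distance. -/
theorem exists_holomorphic_support {E : Type*} [NormedAddCommGroup E] [NormedSpace ℂ E]
    [FiniteDimensional ℂ E] {ρ : E → ℝ} {z : E} (hρ : ContDiffAt ℝ 2 ρ z)
    (h : ∀ w : E, w ≠ 0 → 0 < levi ρ z w) :
    ∃ P : E → ℂ, Differentiable ℂ P ∧ P 0 = 0 ∧ ∃ c > 0, ∀ᶠ w in nhds (0 : E),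
      ρ z + (P w).re + c * ‖w‖ ^ 2 ≤ ρ (z + w) := by
  obtain ⟨c, hc, hlevi⟩ := exists_pos_mul_norm_sq_le_levi h
  let l : E →L[ℂ] ℂ := StrongDual.extendRCLike (fderiv ℝ ρ z)
  let q : E →L[ℂ] E →L[ℂ] ℂ :=
    (complexBilinPart (fderiv ℝ (fderiv ℝ ρ) z)).toContinuousBilinearMap
  refine ⟨fun w => l w + (1 / 2 : ℝ) * q w w, by fun_prop, by simp, c / 2, by positivity, ?_⟩
  filter_upwards [hρ.eventually_abs_taylor_two_le (half_pos hc)] with w hw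
  have hl : (l w).re = fderiv ℝ ρ z w := by
    simp [l, StrongDual.extendRCLike_apply]
  have hq : (q w w).re = (D2 ρ z w w - D2 ρ z (I • w) (I • w)) / 2 :=
    re_complexBilinPart_self _ w
  have hL := hlevi w
  rw [levi] at hL
  rw [Complex.add_re, Complex.re_ofReal_mul, hl, hq]
  linarith [(abs_le.1 hw).1]

/-- If `ρ ∘ f` has a local maximum at `a` and the Levi form of `ρ` is positive definite at `f a`,
then the holomorphic map `f` is constant near `a`. -/
theorem eventually_eq_of_isLocalMax_comp_of_levi_pos {E : Type*} [NormedAddCommGroup E]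
    [NormedSpace ℂ E] [FiniteDimensional ℂ E] {ρ : E → ℝ} {f : ℂ → E} {a : ℂ}
    (hρ : ContDiffAt ℝ 2 ρ (f a)) (h : ∀ w : E, w ≠ 0 → 0 < levi ρ (f a) w)
    (hf : ∀ᶠ ζ in nhds a, DifferentiableAt ℂ f ζ) (hmax : IsLocalMax (ρ ∘ f) a) :
    ∀ᶠ ζ in nhds a, f ζ = f a := by
  obtain ⟨P, hP, hP0, c, hc, hle⟩ := exists_holomorphic_support hρ h
  have htend : Filter.Tendsto (fun ζ => f ζ - f a) (nhds a) (nhds 0) := by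
    simpa using hf.self_of_nhds.continuousAt.tendsto.sub_const (f a)
  have hre : ∀ᶠ ζ in nhds a, (P (f ζ - f a)).re + c * ‖f ζ - f a‖ ^ 2 ≤ 0 := by
    filter_upwards [htend.eventually hle, hmax] with ζ h1 h2
    rw [add_sub_cancel] at h1
    simp only [Function.comp_apply] at h2
    linarith
  have hexp := Complex.eventually_eq_of_isLocalMax_norm
    (f := fun ζ => Complex.exp (P (f ζ - f a))) (c := a)
    (hf.mono fun ζ hζ => ((hP _).comp ζ (hζ.sub_const (f a))).cexp) (by
      filter_upwards [hre] with ζ hζ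
      have : (P (f ζ - f a)).re ≤ 0 := by
        nlinarith [sq_nonneg ‖f ζ - f a‖]
      simpa [Complex.norm_exp, hP0] using this)
  filter_upwards [hre, hexp] with ζ h1 h2
  have h3 : (P (f ζ - f a)).re = 0 := by
    simpa [Complex.norm_exp, hP0] using congrArg norm h2
  have h4 : ‖f ζ - f a‖ ^ 2 ≤ 0 := by
    nlinarith [sq_nonneg ‖f ζ - f a‖]
  exact sub_eq_zero.1 (norm_eq_zero.1 (pow_eq_zero_iff two_ne_zero |>.1
    (le_antisymm h4 (sq_nonneg _))))

/-- Strong maximum principle: if `ρ` is `C²` and strongly plurisubharmonic on `U`, `f` is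
continuous on the closed unit disc, holomorphic and nonconstant in the open disc, with
values in `U`, and `ρ ∘ f ≤ 0` on the unit circle, then `ρ ∘ f < 0` on the open disc. -/
theorem spsh_composition_strong_max_principle (n : ℕ)
    (U : Set (EuclideanSpace ℂ (Fin n))) (hUopen : IsOpen U)
    (ρ : EuclideanSpace ℂ (Fin n) → ℝ) (hρC : ContDiffOn ℝ 2 ρ U)
    (hspsh : ∀ z ∈ U, ∀ w : EuclideanSpace ℂ (Fin n), w ≠ 0 → 0 < levi ρ z w)
    (f : ℂ → EuclideanSpace ℂ (Fin n))
    (hfc : ContinuousOn f (closedBall 0 1))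
    (hfh : DifferentiableOn ℂ f (ball 0 1))
    (hnc : ¬ ∀ ζ ∈ ball (0:ℂ) 1, f ζ = f 0)
    (hfU : Set.MapsTo f (closedBall 0 1) U)
    (hbd : ∀ ζ : ℂ, ‖ζ‖ = 1 → ρ (f ζ) ≤ 0) :
    ∀ ζ ∈ ball (0:ℂ) 1, ρ (f ζ) < 0 := by
  intro ζ₀ hζ₀
  by_contra! hcon
  obtain ⟨b, hb, hbmax⟩ := (isCompact_closedBall (0 : ℂ) 1).exists_isMaxOn ⟨0, by simp⟩
    (hρC.continuousOn.comp hfc hfU)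
  obtain ⟨a, ha, hamax⟩ : ∃ a ∈ ball (0 : ℂ) 1, IsMaxOn (ρ ∘ f) (closedBall 0 1) a := by
    by_cases hb1 : ‖b‖ = 1
    · refine ⟨ζ₀, hζ₀, fun ζ hζ => ?_⟩
      exact (hbmax hζ).trans ((hbd b hb1).trans hcon)
    · exact ⟨b, mem_ball_zero_iff.2 (lt_of_le_of_ne (mem_closedBall_zero_iff.1 hb) hb1), hbmax⟩
  have hfaU : f a ∈ U := hfU (ball_subset_closedBall ha)
  have hloc := eventually_eq_of_isLocalMax_comp_of_levi_pos
    (hρC.contDiffAt (hUopen.mem_nhds hfaU)) (hspsh _ hfaU)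
    (Filter.mem_of_superset (isOpen_ball.mem_nhds ha) fun ζ hζ =>
      hfh.differentiableAt (isOpen_ball.mem_nhds hζ))
    (hamax.isLocalMax (Filter.mem_of_superset (isOpen_ball.mem_nhds ha) ball_subset_closedBall))
  have heq : EqOn f (fun _ => f a) (ball 0 1) :=
    (hfh.analyticOnNhd isOpen_ball).eqOn_of_preconnected_of_eventuallyEq analyticOnNhd_const
      (convex_ball 0 1).isPreconnected ha hloc
  exact hnc fun ζ hζ => (heq hζ).trans (heq (mem_ball_self one_pos)).symm
end

section
/- (Hopf lemma on the disc.) Let u : closure(𝔻) → ℝ be continuous on the closed unit disc, twice real-differentiable on 𝔻 with Δu(ζ) ≥ 0 for all ζ ∈ 𝔻, and suppose u(ζ) < 0 for all ζ ∈ 𝔻. Let p ∈ ℂ with |p| = 1 and u(p) = 0. Then there exist c > 0 and t₀ ∈ (0,1) such that u((1−t)·p) ≤ −c·t for all t ∈ (0, t₀). -/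
open Complex Metric Set Bornology

section

open Filter Topology

/-- Second derivative test, necessary condition: at a local maximum the second derivative
is nonpositive. -/
theorem IsLocalMax.second_deriv_nonpos {f f' : ℝ → ℝ} {x c : ℝ} (hmax : IsLocalMax f x)
    (hf : ∀ᶠ t in 𝓝 x, HasDerivAt f (f' t) t) (hf' : HasDerivAt f' c x) : c ≤ 0 := by
  by_contra! hc
  have hderiv : deriv f =ᶠ[𝓝 x] f' := hf.mono fun t ht => ht.deriv
  have hmin : IsLocalMin f x := by
    refine isLocalMin_of_deriv_deriv_pos ?_ hmax.deriv_eq_zero hf.self_of_nhds.continuousAt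
    rwa [hderiv.deriv_eq, hf'.deriv]
  have hconst : f =ᶠ[𝓝 x] fun _ => f x := by
    filter_upwards [hmax, hmin] with t h₁ h₂ using le_antisymm h₁ h₂
  have hzero : f' =ᶠ[𝓝 x] fun _ => 0 := by
    filter_upwards [hderiv, hconst.deriv] with t h₁ h₂
    rw [← h₁, h₂, deriv_const]
  rw [← hf'.deriv, hzero.deriv_eq, deriv_const] at hc
  exact hc.false

/-- The function `u` composed with a real line through `z` has derivatives given by the
Fréchet derivatives of `u`. -/
theorem hasDerivAt_along_line {E F : Type*} [NormedAddCommGroup E] [NormedSpace ℝ E]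
    [NormedAddCommGroup F] [NormedSpace ℝ F] {f : E → F} {z e : E} {t : ℝ}
    (hf : DifferentiableAt ℝ f (z + t • e)) :
    HasDerivAt (fun r : ℝ => f (z + r • e)) (fderiv ℝ f (z + t • e) e) t := by
  have hline : HasDerivAt (fun r : ℝ => z + r • e) e t := by
    simpa using ((hasDerivAt_id t).smul_const e).const_add z
  exact hf.hasFDerivAt.comp_hasDerivAt t hline

/-- A radial function, vanishing on the unit circle, which is strictly subharmonic where
`3 / 4 ≤ ‖z‖ ^ 2`. -/
noncomputable def hopfBarrier (z : ℂ) : ℝ := (1 - normSq z) + 2 * (1 - normSq z) ^ 2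

theorem continuous_hopfBarrier : Continuous hopfBarrier := by
  unfold hopfBarrier
  have := continuous_normSq
  fun_prop

/-- Second order condition, in a unit direction `e`, at a local maximum of `u + ε * hopfBarrier`. -/
theorem D2_add_barrier_nonpos {u : ℂ → ℝ} {ε b : ℝ} {z e : ℂ}
    (hu : ∀ᶠ ζ in 𝓝 z, DifferentiableAt ℝ u ζ) (hu' : DifferentiableAt ℝ (fderiv ℝ u) z)
    (hmax : IsLocalMax (fun ζ => u ζ + ε * hopfBarrier ζ) z)
    (he : ∀ t : ℝ, normSq (z + t • e) = normSq z + 2 * t * b + t ^ 2) :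
    D2 u z e e + ε * (-2 - 8 * (1 - normSq z) + 16 * b ^ 2) ≤ 0 := by
  have htend : Tendsto (fun t : ℝ => z + t • e) (𝓝 0) (𝓝 z) := by
    have : Continuous fun t : ℝ => z + t • e := by fun_prop
    simpa using this.tendsto 0
  have hmax' : IsLocalMax (fun t : ℝ => u (z + t • e) + ε * hopfBarrier (z + t • e)) 0 := by
    filter_upwards [htend.eventually hmax] with t ht
    simpa using ht
  have hs : ∀ t : ℝ, HasDerivAt (fun r : ℝ => 1 - (normSq z + 2 * r * b + r ^ 2))
      (-(2 * b + 2 * t)) t := fun t => by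
    have := ((((hasDerivAt_id t).const_mul 2).mul_const b).const_add (normSq z)).add
      ((hasDerivAt_id t).pow 2)
    exact (this.const_sub 1).congr_deriv (by simp)
  refine hmax'.second_deriv_nonpos (f' := fun t => fderiv ℝ u (z + t • e) e +
    ε * (-(2 * b + 2 * t) + 2 * (2 * (1 - (normSq z + 2 * t * b + t ^ 2)) * -(2 * b + 2 * t))))
    ?_ ?_
  · filter_upwards [htend.eventually hu] with t ht
    simp only [hopfBarrier, he]
    refine (hasDerivAt_along_line ht).add (HasDerivAt.const_mul ε ?_)
    exact ((hs t).add (((hs t).pow 2).const_mul 2)).congr_deriv (by simp)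
  · have h₁ : HasDerivAt (fun t : ℝ => fderiv ℝ u (z + t • e) e) (D2 u z e e) 0 := by
      have h := hasDerivAt_along_line (f := fderiv ℝ u) (z := z) (e := e) (t := 0)
        (by simpa using hu')
      simpa [D2] using h.clm_apply (hasDerivAt_const (0 : ℝ) e)
    have h₂ : HasDerivAt (fun t : ℝ => -(2 * b + 2 * t)) (-2) 0 := by
      simpa [Pi.neg_def] using (((hasDerivAt_id (0 : ℝ)).const_mul 2).const_add (2 * b)).neg
    refine h₁.add (HasDerivAt.const_mul ε ?_)
    exact (h₂.add ((((hs 0).const_mul 2).mul h₂).const_mul 2)).congr_deriv (by ring)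

/-- If `u` is subharmonic at `z`, then `u + ε * hopfBarrier` has no local maximum at `z`
when `3 / 4 ≤ ‖z‖ ^ 2`. -/
theorem not_isLocalMax_add_barrier {u : ℂ → ℝ} {ε : ℝ} {z : ℂ} (hε : 0 < ε)
    (hu : ∀ᶠ ζ in 𝓝 z, DifferentiableAt ℝ u ζ) (hu' : DifferentiableAt ℝ (fderiv ℝ u) z)
    (hlap : 0 ≤ lap u z) (hz : 3 / 4 ≤ normSq z) :
    ¬ IsLocalMax (fun ζ => u ζ + ε * hopfBarrier ζ) z := by
  intro hmax
  have h₁ := D2_add_barrier_nonpos (e := 1) (b := z.re) hu hu' hmax fun t => by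
    simp [normSq_apply]
    ring
  have h₂ := D2_add_barrier_nonpos (e := I) (b := z.im) hu hu' hmax fun t => by
    simp [normSq_apply]
    ring
  have hz' : normSq z = z.re ^ 2 + z.im ^ 2 := by rw [normSq_apply]; ring
  unfold lap at hlap
  nlinarith

end

/-- Hopf lemma on the disc: a subharmonic function, continuous on the closed unit disc and
negative in the open disc, which vanishes at a boundary point `p`, decreases at least
linearly along the inner radius at `p`. -/
theorem hopf_lemma_disc (u : ℂ → ℝ)
    (huc : ContinuousOn u (closedBall 0 1))
    -- u is twice real-differentiable on 𝔻
    (hud : ∀ ζ ∈ ball (0:ℂ) 1, DifferentiableAt ℝ u ζ ∧ DifferentiableAt ℝ (fderiv ℝ u) ζ)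
    (hsub : ∀ ζ ∈ ball (0:ℂ) 1, 0 ≤ lap u ζ)
    (hneg : ∀ ζ ∈ ball (0:ℂ) 1, u ζ < 0)
    (p : ℂ) (hp : ‖p‖ = 1) (hup : u p = 0) :
    ∃ c : ℝ, 0 < c ∧ ∃ t₀ ∈ Set.Ioo (0:ℝ) 1,
      ∀ t ∈ Set.Ioo (0:ℝ) t₀, u (((1 - t : ℝ) : ℂ) * p) ≤ -c * t := by
  have hle : ∀ ζ ∈ closedBall (0 : ℂ) 1, u ζ ≤ 0 := by
    rw [← closure_ball (0 : ℂ) one_ne_zero] at huc ⊢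
    exact fun ζ hζ => le_on_closure (fun x hx => (hneg x hx).le) huc continuousOn_const hζ
  have hball : ∀ ζ : ℂ, ζ ∈ ball (0 : ℂ) 1 ↔ normSq ζ < 1 := fun ζ => by
    rw [mem_ball_zero_iff, normSq_eq_norm_sq, sq_lt_one_iff₀ (norm_nonneg ζ)]
  have hcball : ∀ ζ : ℂ, ζ ∈ closedBall (0 : ℂ) 1 ↔ normSq ζ ≤ 1 := fun ζ => by
    rw [mem_closedBall_zero_iff, normSq_eq_norm_sq, sq_le_one_iff₀ (norm_nonneg ζ)]
  have hcompact : ∀ {S : Set ℂ}, IsClosed S → S ⊆ closedBall 0 1 → IsCompact S :=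
    fun hS h => (isCompact_closedBall (0 : ℂ) 1).of_isClosed_subset hS h
  obtain ⟨ε, hε, hcircle⟩ : ∃ ε > 0, ∀ ζ : ℂ, normSq ζ = 3 / 4 → u ζ + ε * (3 / 8) ≤ 0 := by
    have hsub' : {ζ : ℂ | normSq ζ = 3 / 4} ⊆ closedBall 0 1 := fun ζ hζ => by
      rw [hcball, hζ]; norm_num
    rcases {ζ : ℂ | normSq ζ = 3 / 4}.eq_empty_or_nonempty with h | h
    · exact ⟨1, one_pos, fun ζ hζ => (h.subset hζ).elim⟩
    obtain ⟨m, hm, hmm⟩ := (hcompact (isClosed_eq continuous_normSq continuous_const)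
      hsub').exists_isMaxOn h (huc.mono hsub')
    have hm0 : u m < 0 := hneg m ((hball m).2 (by rw [hm]; norm_num))
    refine ⟨-u m, by linarith, fun ζ hζ => ?_⟩
    have : u ζ ≤ u m := hmm hζ
    linarith
  have hannulus : ∀ ζ : ℂ, 3 / 4 ≤ normSq ζ → normSq ζ ≤ 1 →
      u ζ + ε * hopfBarrier ζ ≤ 0 := by
    intro ζ hζ₁ hζ₂
    have hsub' : {ζ : ℂ | 3 / 4 ≤ normSq ζ ∧ normSq ζ ≤ 1} ⊆ closedBall 0 1 :=
      fun ζ hζ => (hcball ζ).2 hζ.2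
    obtain ⟨m, hm, hmm⟩ := (hcompact ((isClosed_le continuous_const continuous_normSq).inter
      (isClosed_le continuous_normSq continuous_const)) hsub').exists_isMaxOn
      (f := fun ζ => u ζ + ε * hopfBarrier ζ) ⟨ζ, hζ₁, hζ₂⟩
      ((huc.mono hsub').add (continuous_hopfBarrier.const_smul ε).continuousOn)
    refine le_trans (hmm ⟨hζ₁, hζ₂⟩) ?_
    change u m + ε * hopfBarrier m ≤ 0
    obtain ⟨hm₁, hm₂⟩ : 3 / 4 ≤ normSq m ∧ normSq m ≤ 1 := hm
    rcases hm₁.eq_or_lt with h | h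
    · convert hcircle m h.symm using 3
      rw [hopfBarrier, ← h]
      norm_num
    rcases hm₂.eq_or_lt with h' | h'
    · simpa [hopfBarrier, h'] using hle m (hsub' ⟨hm₁, hm₂⟩)
    have hmem := (hball m).2 h'
    have hu : ∀ᶠ ζ in nhds m, DifferentiableAt ℝ u ζ := by
      filter_upwards [isOpen_ball.mem_nhds hmem] with ζ hζ using (hud ζ hζ).1
    refine absurd ?_ (not_isLocalMax_add_barrier hε hu (hud m hmem).2 (hsub m hmem) hm₁)
    filter_upwards [continuous_normSq.continuousAt.eventually (lt_mem_nhds h),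
      continuous_normSq.continuousAt.eventually (gt_mem_nhds h')] with ζ h₁ h₂
    exact hmm ⟨h₁.le, h₂.le⟩
  refine ⟨ε, hε, 1 / 10, by norm_num, fun t ht => ?_⟩
  obtain ⟨ht₀, ht₁⟩ := ht
  have hs : normSq (((1 - t : ℝ) : ℂ) * p) = (1 - t) ^ 2 := by
    rw [normSq_mul, normSq_ofReal, normSq_eq_norm_sq, hp]
    ring
  have h := hannulus (((1 - t : ℝ) : ℂ) * p) (by rw [hs]; nlinarith) (by rw [hs]; nlinarith)
  have hb : t ≤ hopfBarrier (((1 - t : ℝ) : ℂ) * p) := by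
    rw [hopfBarrier, hs]
    nlinarith [sq_nonneg (1 - (1 - t) ^ 2)]
  nlinarith
end

section
/- Let n ≥ 2 and let Ω ⊂ ℂⁿ be a bounded strongly pseudoconvex domain with defining function ρ of class C² on an open set U ⊇ closure(Ω). Let f : ℂ → ℂⁿ be continuous on closure(𝔻), holomorphic and nonconstant on 𝔻, with f(𝔻) ⊆ Ω and ρ(f(ζ)) = 0 for all |ζ| = 1, and suppose the complex derivative f′ extends to a continuous map g : closure(𝔻) → ℂⁿ. Then for every p ∈ ℂ with |p| = 1 one has Dρ(f(p))( p·g(p) ) > 0; in particular g(p) ≠ 0 (f is an immersion along the boundary circle) and the boundary derivative p·g(p) does not lie in the kernel of Dρ(f(p)) (f meets bΩ transversely). -/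
open Complex Metric Set Bornology

open Filter Topology

/-- The second-order necessary condition at a local maximum. -/
theorem IsLocalMax.second_deriv_nonpos_s13 {φ φ' : ℝ → ℝ} {a c : ℝ} (h : IsLocalMax φ a)
    (hφ : ∀ᶠ x in 𝓝 a, HasDerivAt φ (φ' x) x) (hφ' : HasDerivAt φ' c a) : c ≤ 0 := by
  by_contra! hc
  have hd : deriv φ =ᶠ[𝓝 a] φ' := hφ.mono fun x hx => hx.deriv
  have hdd : deriv (deriv φ) a = c := (hφ'.congr_of_eventuallyEq hd).deriv
  have hmin : IsLocalMin φ a :=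
    isLocalMin_of_deriv_deriv_pos (hdd ▸ hc) h.deriv_eq_zero hφ.self_of_nhds.continuousAt
  have hconst : φ =ᶠ[𝓝 a] fun _ => φ a := by
    filter_upwards [h, hmin] with x h₁ h₂ using le_antisymm h₁ h₂
  have hzero := hconst.deriv.deriv_eq
  simp only [deriv_const', hdd] at hzero
  exact hc.ne' hzero

theorem levi_nonneg {E : Type*} [NormedAddCommGroup E] [NormedSpace ℂ E] {ρ : E → ℝ} {z : E}
    (h : ∀ w : E, w ≠ 0 → 0 < levi ρ z w) (w : E) : 0 ≤ levi ρ z w := by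
  rcases eq_or_ne w 0 with rfl | hw
  · simp [levi, D2]
  · exact (h w hw).le

section Barrier

variable {E : Type*} [NormedAddCommGroup E] [NormedSpace ℂ E] [CompleteSpace E]
  {U : Set E} {ρ : E → ℝ} {f : ℂ → E}

/-- The second-order condition along the curve `x ↦ f (ζ₀ * exp (x * τ))` at a local maximum of
`ρ ∘ f` plus a logarithmic barrier. -/
theorem second_deriv_along_exp_nonpos (hUopen : IsOpen U) (hρC : ContDiffOn ℝ 2 ρ U)
    (hfh : DifferentiableOn ℂ f (ball 0 1)) (hfU : MapsTo f (ball 0 1) U)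
    {ζ₀ : ℂ} (hζ₀ : ζ₀ ≠ 0) (hball : ζ₀ ∈ ball (0 : ℂ) 1) {ε : ℝ}
    (hmax : IsLocalMax
      (fun ζ => ρ (f ζ) + ε * (Real.log ‖ζ‖ ^ 2 - Real.log ‖ζ‖)) ζ₀) (τ : ℂ) :
    D2 ρ (f ζ₀) (τ • ζ₀ • deriv f ζ₀) (τ • ζ₀ • deriv f ζ₀)
      + fderiv ℝ ρ (f ζ₀) ((τ * τ) •
          deriv (fun z => (ζ₀ * exp z) • deriv f (ζ₀ * exp z)) 0)
      + 2 * ε * τ.re ^ 2 ≤ 0 := by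
  set G : ℂ → E := fun z => (ζ₀ * exp z) • deriv f (ζ₀ * exp z) with hG
  set L : ℝ := Real.log ‖ζ₀‖
  have hκ : ∀ x : ℝ, HasDerivAt (fun x : ℝ => (x : ℂ) * τ) τ x := fun x => by
    simpa using (hasDerivAt_id x).ofReal_comp.mul_const τ
  have hexp : ∀ z : ℂ, HasDerivAt (fun z => ζ₀ * exp z) (ζ₀ * exp z) z := fun z =>
    (Complex.hasDerivAt_exp z).const_mul ζ₀
  have hcurve : Continuous fun x : ℝ => ζ₀ * exp (x * τ) := by fun_prop
  have hcurve₀ : ζ₀ * exp ((0 : ℝ) * τ) = ζ₀ := by simp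
  have hev : ∀ᶠ x : ℝ in 𝓝 0, ζ₀ * exp (x * τ) ∈ ball (0 : ℂ) 1 :=
    (isOpen_ball.preimage hcurve).mem_nhds (by simpa using hball)
  have hdf : DifferentiableOn ℂ (deriv f) (ball 0 1) := hfh.deriv isOpen_ball
  have hγ : ∀ x : ℝ, ζ₀ * exp (x * τ) ∈ ball (0 : ℂ) 1 →
      HasDerivAt (fun x : ℝ => f (ζ₀ * exp (x * τ))) (τ • G (x * τ)) x := fun x hx =>
    have h₁ : HasDerivAt (fun z => f (ζ₀ * exp z)) (G (x * τ)) (x * τ) :=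
      HasDerivAt.scomp (h := fun z => ζ₀ * exp z) _
        (hfh.differentiableAt (isOpen_ball.mem_nhds hx)).hasDerivAt (hexp _)
    HasDerivAt.scomp (h := fun x : ℝ => (x : ℂ) * τ) x h₁ (hκ x)
  have hGd : DifferentiableAt ℂ G 0 := by
    have h₁ : DifferentiableAt ℂ (deriv f) (ζ₀ * exp 0) := by
      simpa using hdf.differentiableAt (isOpen_ball.mem_nhds hball)
    exact (hexp 0).differentiableAt.smul
      (DifferentiableAt.comp (0 : ℂ) (f := fun z => ζ₀ * exp z) h₁ (hexp 0).differentiableAt)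
  have hγ' : HasDerivAt (fun x : ℝ => τ • G (x * τ)) ((τ * τ) • deriv G 0) 0 := by
    have h₁ : HasDerivAt G (deriv G 0) ((0 : ℝ) * τ) := by simpa using hGd.hasDerivAt
    rw [mul_smul]
    exact (HasDerivAt.scomp (0 : ℝ) h₁ (hκ 0)).const_smul τ
  have hρd : ∀ w ∈ U, HasFDerivAt ρ (fderiv ℝ ρ w) w := fun w hw =>
    ((hρC.contDiffAt (hUopen.mem_nhds hw)).differentiableAt (by norm_num)).hasFDerivAt
  have hρdd : HasFDerivAt (fderiv ℝ ρ) (fderiv ℝ (fderiv ℝ ρ) (f ζ₀)) (f ζ₀) :=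
    (((hρC.contDiffAt (hUopen.mem_nhds (hfU hball))).fderiv_right (m := 1)
      (by norm_num)).differentiableAt (by norm_num)).hasFDerivAt
  have hq : ∀ x : ℝ, HasDerivAt
      (fun x : ℝ => ε * ((L + x * τ.re) ^ 2 - (L + x * τ.re)))
      (ε * (2 * (L + x * τ.re) * τ.re - τ.re)) x := fun x => by
    have h₁ : HasDerivAt (fun x : ℝ => L + x * τ.re) τ.re x := by
      simpa using ((hasDerivAt_id x).mul_const τ.re).const_add L
    simpa using ((h₁.pow 2).sub h₁).const_mul ε
  have hq' : HasDerivAt (fun x : ℝ => ε * (2 * (L + x * τ.re) * τ.re - τ.re))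
      (2 * ε * τ.re ^ 2) 0 := by
    have h₁ : HasDerivAt (fun x : ℝ => L + x * τ.re) τ.re 0 := by
      simpa using ((hasDerivAt_id (0 : ℝ)).mul_const τ.re).const_add L
    exact ((((h₁.const_mul 2).mul_const τ.re).sub_const τ.re).const_mul ε).congr_deriv (by ring)
  have hlog : ∀ x : ℝ, Real.log ‖ζ₀ * exp (x * τ)‖ = L + x * τ.re := fun x => by
    rw [norm_mul, Complex.norm_exp, Real.log_mul (norm_ne_zero_iff.2 hζ₀) (Real.exp_ne_zero _),
      Real.log_exp]
    simp [L]
  have hmax' : IsLocalMax (fun x : ℝ => ρ (f (ζ₀ * exp (x * τ)))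
      + ε * ((L + x * τ.re) ^ 2 - (L + x * τ.re))) 0 := by
    have h₁ := IsLocalMax.comp_continuous (g := fun x : ℝ => ζ₀ * exp (x * τ)) (b := 0)
      (by rw [hcurve₀]; exact hmax) hcurve.continuousAt
    simpa only [Function.comp_def, hlog] using h₁
  refine hmax'.second_deriv_nonpos_s13
    (φ' := fun x => fderiv ℝ ρ (f (ζ₀ * exp (x * τ))) (τ • G (x * τ))
      + ε * (2 * (L + x * τ.re) * τ.re - τ.re)) ?_ ?_
  · filter_upwards [hev] with x hx
    exact ((hρd _ (hfU hx)).comp_hasDerivAt x (hγ x hx)).add (hq x)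
  · have h₀ := hγ 0 (by simpa using hball)
    have h₁ : HasDerivAt (fun x : ℝ => fderiv ℝ ρ (f (ζ₀ * exp (x * τ))))
        (fderiv ℝ (fderiv ℝ ρ) (f ζ₀) (τ • G ((0 : ℝ) * τ))) 0 :=
      HasFDerivAt.comp_hasDerivAt (0 : ℝ) (by rw [hcurve₀]; exact hρdd) h₀
    refine ((h₁.clm_apply hγ').add hq').congr_deriv ?_
    simp [hG, D2]

theorem not_isLocalMax_comp_add_log_barrier (hUopen : IsOpen U) (hρC : ContDiffOn ℝ 2 ρ U)
    (hlevi : ∀ z ∈ U, ∀ w : E, 0 ≤ levi ρ z w)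
    (hfh : DifferentiableOn ℂ f (ball 0 1)) (hfU : MapsTo f (ball 0 1) U)
    {ζ₀ : ℂ} (hζ₀ : ζ₀ ≠ 0) (hball : ζ₀ ∈ ball (0 : ℂ) 1) {ε : ℝ} (hε : 0 < ε) :
    ¬ IsLocalMax (fun ζ => ρ (f ζ) + ε * (Real.log ‖ζ‖ ^ 2 - Real.log ‖ζ‖)) ζ₀ := by
  intro hmax
  have h₁ := second_deriv_along_exp_nonpos hUopen hρC hfh hfU hζ₀ hball hmax 1
  have h₂ := second_deriv_along_exp_nonpos hUopen hρC hfh hfU hζ₀ hball hmax I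
  have h₃ := hlevi _ (hfU hball) (ζ₀ • deriv f ζ₀)
  simp only [levi] at h₃
  simp only [one_smul, one_mul, one_re, I_re, I_mul_I, neg_smul, map_neg] at h₁ h₂
  linarith

/-- A Hopf-type estimate for `ρ ∘ f` near the unit circle. -/
theorem exists_le_mul_norm_sub_one (hUopen : IsOpen U) (hρC : ContDiffOn ℝ 2 ρ U)
    (hlevi : ∀ z ∈ U, ∀ w : E, 0 ≤ levi ρ z w)
    (hfc : ContinuousOn f (closedBall 0 1)) (hfh : DifferentiableOn ℂ f (ball 0 1))
    (hfU : MapsTo f (closedBall 0 1) U) (hneg : ∀ ζ ∈ ball (0 : ℂ) 1, ρ (f ζ) < 0)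
    (hbd : ∀ ζ : ℂ, ‖ζ‖ = 1 → ρ (f ζ) = 0) :
    ∃ ε > 0, ∀ ζ : ℂ, Real.exp (-1) ≤ ‖ζ‖ → ‖ζ‖ ≤ 1 → ρ (f ζ) ≤ ε * (‖ζ‖ - 1) := by
  have hr₀ : 0 < Real.exp (-1) := Real.exp_pos _
  have hr₁ : Real.exp (-1) < 1 := by simp
  have huc : ContinuousOn (fun ζ => ρ (f ζ)) (closedBall 0 1) :=
    hρC.continuousOn.comp hfc hfU
  obtain ⟨ζ₁, hζ₁, hζ₁max⟩ := (isCompact_sphere (0 : ℂ) (Real.exp (-1))).exists_isMaxOn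
    (NormedSpace.sphere_nonempty.2 hr₀.le)
    (huc.mono (sphere_subset_closedBall.trans (closedBall_subset_closedBall hr₁.le)))
  have hm : ρ (f ζ₁) < 0 := hneg _ (by simp_all)
  set ε : ℝ := -ρ (f ζ₁) / 2 with hεdef
  have hε : 0 < ε := by linarith
  let φ : ℂ → ℝ := fun ζ => ρ (f ζ) + ε * (Real.log ‖ζ‖ ^ 2 - Real.log ‖ζ‖)
  let K : Set ℂ := closedBall 0 1 \ ball 0 (Real.exp (-1))
  have hmemK : ∀ ζ : ℂ, ζ ∈ K ↔ ‖ζ‖ ≤ 1 ∧ Real.exp (-1) ≤ ‖ζ‖ := fun ζ => by simp [K]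
  have hKc : IsCompact K := (isCompact_closedBall (0 : ℂ) 1).diff isOpen_ball
  have hlogc : ContinuousOn (fun ζ : ℂ => Real.log ‖ζ‖) K :=
    continuous_norm.continuousOn.log fun ζ hζ => (hr₀.trans_le ((hmemK ζ).1 hζ).2).ne'
  have hφc : ContinuousOn φ K :=
    (huc.mono sdiff_subset).add (continuousOn_const.mul ((hlogc.pow 2).sub hlogc))
  obtain ⟨ζ₀, hζ₀, hζ₀max⟩ := hKc.exists_isMaxOn ⟨1, (hmemK 1).2 (by simp)⟩ hφc
  obtain ⟨hle, hge⟩ := (hmemK ζ₀).1 hζ₀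
  have hφ₀ : φ ζ₀ ≤ 0 := by
    rcases hle.eq_or_lt with h₁ | h₁
    · simp [φ, hbd ζ₀ h₁, h₁]
    rcases hge.eq_or_lt with h₂ | h₂
    · have h₃ : ρ (f ζ₀) ≤ ρ (f ζ₁) := hζ₁max (by simp [← h₂])
      simp only [φ, ← h₂, Real.log_exp]
      linarith
    · have hmax : IsLocalMax φ ζ₀ := by
        refine hζ₀max.isLocalMax (mem_of_superset
          (((isOpen_lt continuous_const continuous_norm).inter
            (isOpen_lt continuous_norm continuous_const)).mem_nhds ⟨h₂, h₁⟩) ?_)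
        exact fun ζ hζ => (hmemK ζ).2 ⟨hζ.2.le, hζ.1.le⟩
      exact absurd hmax (not_isLocalMax_comp_add_log_barrier hUopen hρC hlevi hfh
        (hfU.mono_left ball_subset_closedBall) (norm_pos_iff.1 (hr₀.trans h₂))
        (by simpa using h₁) hε)
  refine ⟨ε, hε, fun ζ h₁ h₂ => ?_⟩
  have h₃ : φ ζ ≤ 0 := (hζ₀max ((hmemK ζ).2 ⟨h₂, h₁⟩)).trans hφ₀
  have h₄ := Real.log_le_sub_one_of_pos (hr₀.trans_le h₁)
  have h₅ := mul_le_mul_of_nonneg_left h₄ hε.le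
  have h₆ := mul_nonneg hε.le (sq_nonneg (Real.log ‖ζ‖))
  simp only [φ] at h₃
  linarith

end Barrier

/-- The radial derivative at a boundary point of a disc whose derivative extends continuously. -/
theorem hasDerivWithinAt_radial {E : Type*} [NormedAddCommGroup E] [NormedSpace ℂ E]
    {f g : ℂ → E} (hfc : ContinuousOn f (closedBall 0 1))
    (hfh : DifferentiableOn ℂ f (ball 0 1)) (hgc : ContinuousOn g (closedBall 0 1))
    (hgd : ∀ ζ ∈ ball (0 : ℂ) 1, g ζ = deriv f ζ) {p : ℂ} (hp : ‖p‖ = 1) :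
    HasDerivWithinAt (fun r : ℝ => f (r * p)) (p • g p) (Iic 1) 1 := by
  have hnorm : ∀ r ∈ Ioo (0 : ℝ) 1, (r : ℂ) * p ∈ ball (0 : ℂ) 1 := fun r hr => by
    simp [hp, abs_of_pos hr.1, hr.2]
  have hκ : ∀ r : ℝ, HasDerivAt (fun r : ℝ => (r : ℂ) * p) p r := fun r => by
    simpa using (hasDerivAt_id r).ofReal_comp.mul_const p
  have hd : ∀ r ∈ Ioo (0 : ℝ) 1,
      HasDerivAt (fun r : ℝ => f (r * p)) (p • g (r * p)) r := fun r hr => by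
    rw [hgd _ (hnorm r hr)]
    exact HasDerivAt.scomp r
      (hfh.differentiableAt (isOpen_ball.mem_nhds (hnorm r hr))).hasDerivAt (hκ r)
  have hmaps : MapsTo (fun r : ℝ => (r : ℂ) * p) (Ioo 0 1) (closedBall 0 1) := fun r hr =>
    ball_subset_closedBall (hnorm r hr)
  have hp' : ((1 : ℝ) : ℂ) * p ∈ closedBall (0 : ℂ) 1 := by simp [hp]
  have hκc : ContinuousWithinAt (fun r : ℝ => (r : ℂ) * p) (Ioo 0 1) 1 :=
    (hκ 1).continuousAt.continuousWithinAt
  have hmem : Ioo (0 : ℝ) 1 ∈ 𝓝[<] (1 : ℝ) := Ioo_mem_nhdsLT one_pos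
  refine hasDerivWithinAt_Iic_of_tendsto_deriv (s := Ioo 0 1)
    (fun r hr => (hd r hr).differentiableAt.differentiableWithinAt)
    (ContinuousWithinAt.comp (f := fun r : ℝ => (r : ℂ) * p) (g := f) (hfc _ hp') hκc hmaps)
    hmem ?_
  have hlim : ContinuousWithinAt (fun r : ℝ => p • g (r * p)) (Ioo 0 1) 1 :=
    (ContinuousWithinAt.comp (f := fun r : ℝ => (r : ℂ) * p) (g := g) (hgc _ hp') hκc
      hmaps).const_smul p
  have hlim' : Tendsto (fun r : ℝ => p • g (r * p)) (𝓝[<] 1) (𝓝 (p • g p)) := by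
    have h₁ := hlim.tendsto
    rw [nhdsWithin_Ioo_eq_nhdsLT one_pos] at h₁
    simpa using h₁
  exact hlim'.congr' (mem_of_superset hmem fun r hr => (hd r hr).deriv.symm)

/-- A nonconstant holomorphic disc in a bounded strongly pseudoconvex domain, smooth up to
the boundary and attached to `bΩ` along the circle, is an immersion along the boundary
and meets `bΩ` transversely: `Dρ(f(p))(p·f′(p)) > 0` for every boundary point `p`. -/
theorem boundary_transversality_of_attached_disc (n : ℕ) (hn : 2 ≤ n)
    (Ω U : Set (EuclideanSpace ℂ (Fin n))) (ρ : EuclideanSpace ℂ (Fin n) → ℝ)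
    (hΩbd : IsBounded Ω) (hUopen : IsOpen U) (hΩU : closure Ω ⊆ U)
    (hρC : ContDiffOn ℝ 2 ρ U)
    (hspsh : ∀ z ∈ U, ∀ w : EuclideanSpace ℂ (Fin n), w ≠ 0 → 0 < levi ρ z w)
    (hΩdef : Ω = {z ∈ U | ρ z < 0})
    (hDρ : ∀ z ∈ frontier Ω, fderiv ℝ ρ z ≠ 0)
    (f : ℂ → EuclideanSpace ℂ (Fin n))
    (hfc : ContinuousOn f (closedBall 0 1))
    (hfh : DifferentiableOn ℂ f (ball 0 1))
    (hnc : ¬ ∀ ζ ∈ ball (0:ℂ) 1, f ζ = f 0)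
    (hfΩ : Set.MapsTo f (ball 0 1) Ω)
    (hbd : ∀ ζ : ℂ, ‖ζ‖ = 1 → ρ (f ζ) = 0)
    (g : ℂ → EuclideanSpace ℂ (Fin n))
    (hgc : ContinuousOn g (closedBall 0 1))
    (hgd : ∀ ζ ∈ ball (0:ℂ) 1, g ζ = deriv f ζ) :
    ∀ p : ℂ, ‖p‖ = 1 →
      0 < fderiv ℝ ρ (f p) (p • g p) ∧ g p ≠ 0 := by
  intro p hp
  have hfcl : MapsTo f (closedBall 0 1) U := fun ζ hζ => by
    refine hΩU (hfΩ.closure_of_continuousOn ?_ ?_)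
    · rwa [closure_ball _ one_ne_zero]
    · rwa [closure_ball _ one_ne_zero]
  have hneg : ∀ ζ ∈ ball (0 : ℂ) 1, ρ (f ζ) < 0 := fun ζ hζ => by
    have h₁ := hfΩ hζ
    rw [hΩdef] at h₁
    exact h₁.2
  obtain ⟨ε, hε, hle⟩ := exists_le_mul_norm_sub_one hUopen hρC
    (fun z hz w => levi_nonneg (hspsh z hz) w) hfc hfh hfcl hneg hbd
  have hpU : f p ∈ U := hfcl (by simp [hp])
  have hρd : HasFDerivAt ρ (fderiv ℝ ρ (f p)) (f p) :=
    ((hρC.contDiffAt (hUopen.mem_nhds hpU)).differentiableAt (by norm_num)).hasFDerivAt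
  have hder : HasDerivWithinAt (fun r : ℝ => ρ (f (r * p)))
      (fderiv ℝ ρ (f p) (p • g p)) (Iic 1) 1 :=
    HasFDerivAt.comp_hasDerivWithinAt (1 : ℝ) (by simpa using hρd)
      (hasDerivWithinAt_radial hfc hfh hgc hgd hp)
  have hpos : 0 < fderiv ℝ ρ (f p) (p • g p) := by
    refine hε.trans_le (ge_of_tendsto
      (hasDerivWithinAt_iff_tendsto_slope' (s := Iio 1) (by simp) |>.1
        (hder.mono Iio_subset_Iic_self)) ?_)
    filter_upwards [Ioo_mem_nhdsLT (show Real.exp (-1) < 1 by simp)] with r hr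
    have hr₀ : 0 < r := (Real.exp_pos _).trans hr.1
    have hnorm : ‖(r : ℂ) * p‖ = r := by simp [hp, abs_of_pos hr₀]
    have h₁ := hle (r * p) (by rw [hnorm]; exact hr.1.le) (by rw [hnorm]; exact hr.2.le)
    rw [hnorm] at h₁
    rw [slope_def_field, le_div_iff_of_neg (by linarith [hr.2])]
    simpa [hbd p hp] using h₁
  refine ⟨hpos, fun h => ?_⟩
  simp [h] at hpos
end

section
/- Let n ≥ 2, let U ⊆ ℂⁿ be open, and let ρ : U → ℝ be of class C¹ with real differential Dρ(z) ≠ 0 for every z ∈ U. Let γ : [0,1] → U be a continuous loop, i.e., γ(0) = γ(1). Then there exists a continuous map v : [0,1] → ℂⁿ with v(0) = v(1) such that for every t ∈ [0,1]: |v(t)| = 1 and ∂ρ(γ(t))(v(t)) = 0. (The complex tangent hyperplane field ker ∂ρ admits a nonvanishing continuous section along every loop.) -/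
open Complex Metric Set Bornology

/-- A continuous loop in a real normed space is a uniform limit of `C¹` loops. -/
lemma exists_contDiff_loop_near {F : Type*} [NormedAddCommGroup F] [NormedSpace ℝ F]
    {a : ℝ → F} (ha : ContinuousOn a (Icc 0 1)) (hloop : a 0 = a 1) {ε : ℝ} (hε : 0 < ε) :
    ∃ b : ℝ → F, ContDiff ℝ 1 b ∧ b 0 = b 1 ∧ ∀ t ∈ Icc (0 : ℝ) 1, ‖a t - b t‖ < ε := by
  have hf : Continuous (IccExtend (zero_le_one' ℝ) ((Icc 0 1).domRestrict a)) :=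
    ha.domRestrict.Icc_extend'
  obtain ⟨g, hg, hgf, -⟩ := hf.exists_contDiff_approx (ε := fun _ ↦ ε / 3) 1
    continuous_const (fun _ ↦ by positivity)
  have hga : ∀ t ∈ Icc (0 : ℝ) 1, ‖g t - a t‖ < ε / 3 := fun t ht ↦ by
    have := hgf t
    rwa [IccExtend_of_mem _ _ ht, dist_eq_norm] at this
  refine ⟨fun t ↦ g t + t • (g 0 - g 1), ?_, by simp, fun t ht ↦ ?_⟩
  · exact hg.add (contDiff_id.smul contDiff_const)
  have h0 := hga 0 (by simp)
  have h1 := hga 1 (by simp)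
  have ht' : ‖t • (g 0 - g 1)‖ < ε / 3 + ε / 3 := by
    have hle : ‖g 0 - g 1‖ ≤ ‖g 0 - a 0‖ + ‖g 1 - a 1‖ := by
      rw [← hloop]
      simpa [dist_eq_norm] using dist_triangle_right (g 0) (g 1) (a 0)
    rw [norm_smul, Real.norm_of_nonneg ht.1]
    nlinarith [ht.2, norm_nonneg (g 0 - g 1)]
  calc ‖a t - (g t + t • (g 0 - g 1))‖ = ‖(a t - g t) - t • (g 0 - g 1)‖ := by
        rw [sub_sub]
    _ ≤ ‖a t - g t‖ + ‖t • (g 0 - g 1)‖ := norm_sub_le _ _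
    _ < ε := by linarith [norm_sub_rev (a t) (g t), hga t ht]

/-- The complex lines spanned by the points of a `C¹` curve do not cover a complex vector space of
dimension at least two. -/
lemma exists_forall_smul_ne {E : Type*} [NormedAddCommGroup E] [NormedSpace ℂ E]
    [FiniteDimensional ℂ E] (hE : 2 ≤ Module.finrank ℂ E) {b : ℝ → E} (hb : ContDiff ℝ 1 b) :
    ∃ c : E, ∀ (t : ℝ) (l : ℂ), l • b t ≠ c := by
  have : FiniteDimensional ℝ E := FiniteDimensional.complexToReal E
  have hsm : ContDiff ℝ 1 (fun p : ℂ × ℝ ↦ p.1 • b p.2) :=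
    contDiff_fst.smul (hb.comp contDiff_snd)
  have hdim : Module.finrank ℝ (ℂ × ℝ) < Module.finrank ℝ E := by
    rw [finrank_real_of_complex E, Module.finrank_prod, Complex.finrank_real_complex,
      Module.finrank_self]
    omega
  obtain ⟨c, hc⟩ := (hsm.dense_compl_range_of_finrank_lt_finrank hdim).nonempty
  exact ⟨c, fun t l h ↦ hc ⟨(l, t), h⟩⟩

section Projection

variable {E : Type*} [NormedAddCommGroup E] [InnerProductSpace ℂ E]

/-- The projection of `w` to the orthogonal complement of `a`, scaled by `‖a‖ ^ 2`. -/
noncomputable def scaledProj (a w : E) : E := inner ℂ a a • w - inner ℂ a w • a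

lemma inner_scaledProj (a w : E) : inner ℂ a (scaledProj a w) = 0 := by
  simp only [scaledProj, inner_sub_right, inner_smul_right]
  ring

lemma exists_smul_eq_of_scaledProj_eq_zero {a w : E} (ha : a ≠ 0) (h : scaledProj a w = 0) :
    ∃ l : ℂ, l • a = w := by
  refine ⟨(inner ℂ a a)⁻¹ * inner ℂ a w, ?_⟩
  rw [mul_smul, ← sub_eq_zero.mp h, inv_smul_smul₀ (inner_self_ne_zero.mpr ha)]

lemma inner_ne_zero_of_norm_sub_lt {a b : E} (h : ‖a - b‖ < ‖a‖) : inner ℂ b a ≠ 0 := by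
  intro h0
  have h1 : inner ℂ (a - b) a = ((‖a‖ ^ 2 : ℝ) : ℂ) := by
    rw [inner_sub_left, h0, sub_zero, inner_self_eq_norm_sq_to_K]
    norm_cast
  have h2 := norm_inner_le_norm (𝕜 := ℂ) (a - b) a
  rw [h1, Complex.norm_real, Real.norm_of_nonneg (by positivity)] at h2
  nlinarith [norm_nonneg (a - b)]

/-- Projecting a vector `c` first off `b` and then off a nearby `a` gives a nonzero vector
unless `c` lies on the line of `b`. -/
lemma scaledProj_scaledProj_ne_zero {a b c : E} (h : ‖a - b‖ < ‖a‖)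
    (hc : ∀ l : ℂ, l • b ≠ c) : scaledProj a (scaledProj b c) ≠ 0 := by
  have hba := inner_ne_zero_of_norm_sub_lt h
  have ha : a ≠ 0 := by rintro rfl; simp at hba
  have hb : b ≠ 0 := by rintro rfl; simp at hba
  intro h0
  obtain ⟨l, hl⟩ := exists_smul_eq_of_scaledProj_eq_zero ha h0
  have hw := inner_scaledProj b c
  rw [← hl, inner_smul_right, mul_eq_zero, or_iff_left hba] at hw
  rw [hw, zero_smul] at hl
  obtain ⟨m, hm⟩ := exists_smul_eq_of_scaledProj_eq_zero hb hl.symm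
  exact hc m hm

lemma ContinuousOn.scaledProj {X : Type*} [TopologicalSpace X] {s : Set X} {a w : X → E}
    (ha : ContinuousOn a s) (hw : ContinuousOn w s) :
    ContinuousOn (fun x ↦ scaledProj (a x) (w x)) s :=
  ((ha.inner (𝕜 := ℂ) ha).smul hw).sub ((ha.inner (𝕜 := ℂ) hw).smul ha)

/-- The orthogonal complement of a continuous nonvanishing loop of vectors has a continuous unit
section closing up along the loop. -/
lemma exists_unit_section_orthogonal [FiniteDimensional ℂ E] (hE : 2 ≤ Module.finrank ℂ E)
    {a : ℝ → E} (ha : ContinuousOn a (Icc 0 1)) (hloop : a 0 = a 1)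
    (hne : ∀ t ∈ Icc (0 : ℝ) 1, a t ≠ 0) :
    ∃ v : ℝ → E, ContinuousOn v (Icc 0 1) ∧ v 0 = v 1 ∧
      ∀ t ∈ Icc (0 : ℝ) 1, ‖v t‖ = 1 ∧ inner ℂ (a t) (v t) = 0 := by
  obtain ⟨t₀, ht₀, hmin⟩ := isCompact_Icc.exists_isMinOn
    (nonempty_Icc.mpr (zero_le_one' ℝ)) ha.norm
  obtain ⟨b, hb, hb01, hab⟩ :=
    exists_contDiff_loop_near ha hloop (norm_pos_iff.mpr (hne t₀ ht₀))
  obtain ⟨c, hc⟩ := exists_forall_smul_ne hE hb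
  set u : ℝ → E := fun t ↦ scaledProj (a t) (scaledProj (b t) c) with hu
  have huc : ContinuousOn u (Icc 0 1) :=
    ha.scaledProj (hb.continuous.continuousOn.scaledProj continuousOn_const)
  have hu0 : ∀ t ∈ Icc (0 : ℝ) 1, u t ≠ 0 := fun t ht ↦
    scaledProj_scaledProj_ne_zero ((hab t ht).trans_le (hmin ht)) (hc t)
  refine ⟨fun t ↦ ((‖u t‖⁻¹ : ℝ) : ℂ) • u t, ?_, ?_, fun t ht ↦ ⟨?_, ?_⟩⟩
  · exact (Complex.continuous_ofReal.comp_continuousOn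
      (huc.norm.inv₀ fun t ht ↦ norm_ne_zero_iff.mpr (hu0 t ht))).smul huc
  · simp only [hu, hloop, hb01]
  · rw [norm_smul, Complex.norm_real, norm_inv, norm_norm,
      inv_mul_cancel₀ (norm_ne_zero_iff.mpr (hu0 t ht))]
  · rw [inner_smul_right, inner_scaledProj, mul_zero]

end Projection

/-- The complex tangent hyperplane field `ker ∂ρ` admits a continuous nonvanishing unit
section along every continuous loop in `{Dρ ≠ 0}` (for `n ≥ 2`). -/
theorem unit_section_of_complex_tangent_field_along_loop (n : ℕ) (hn : 2 ≤ n)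
    (U : Set (EuclideanSpace ℂ (Fin n))) (hUopen : IsOpen U)
    (ρ : EuclideanSpace ℂ (Fin n) → ℝ) (hρC : ContDiffOn ℝ 1 ρ U)
    (hDρ : ∀ z ∈ U, fderiv ℝ ρ z ≠ 0)
    (γ : ℝ → EuclideanSpace ℂ (Fin n))
    (hγc : ContinuousOn γ (Set.Icc 0 1))
    (hγU : Set.MapsTo γ (Set.Icc 0 1) U)
    (hloop : γ 0 = γ 1) :
    ∃ v : ℝ → EuclideanSpace ℂ (Fin n),
      ContinuousOn v (Set.Icc 0 1) ∧ v 0 = v 1 ∧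
      ∀ t ∈ Set.Icc (0:ℝ) 1, ‖v t‖ = 1 ∧ cdiff ρ (γ t) (v t) = 0 := by
  set A : ℝ → EuclideanSpace ℂ (Fin n) := fun t ↦
    (InnerProductSpace.toDual ℂ _).symm
      (StrongDual.extendRCLikeₗᵢ (𝕜 := ℂ) (fderiv ℝ ρ (γ t))) with hA
  have hAinner : ∀ t w, cdiff ρ (γ t) w = (1 / 2 : ℂ) * inner ℂ (A t) w := fun t w ↦ by
    rw [hA, InnerProductSpace.toDual_symm_apply]
    rfl
  have hdρ : ContinuousOn (fun t ↦ fderiv ℝ ρ (γ t)) (Icc 0 1) :=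
    (hρC.continuousOn_fderiv_of_isOpen hUopen le_rfl).comp hγc hγU
  have hAc : ContinuousOn A (Icc 0 1) :=
    (LinearIsometryEquiv.continuous _).comp_continuousOn
      ((LinearIsometryEquiv.continuous _).comp_continuousOn hdρ)
  obtain ⟨v, hv, hv01, hvt⟩ := exists_unit_section_orthogonal (by simpa using hn) hAc
    (by simp only [hA, hloop]) (fun t ht ↦ by simpa [hA] using hDρ _ (hγU ht))
  exact ⟨v, hv, hv01, fun t ht ↦ ⟨(hvt t ht).1, by rw [hAinner, (hvt t ht).2, mul_zero]⟩⟩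
end

section
/- (Inner functions on the disc extend holomorphically across the boundary.) Let f : closure(𝔻) → ℂ be continuous on the closed unit disc, holomorphic on 𝔻, and satisfy |f(ζ)| = 1 for every ζ with |ζ| = 1. Then there exist an open set V ⊆ ℂ with closure(𝔻) ⊆ V and a holomorphic function g : V → ℂ such that g(ζ) = f(ζ) for all ζ ∈ closure(𝔻). -/
open Complex Metric Set

open scoped ComplexConjugate Real

/-- The reflection of `f` in the unit circle, `w ↦ 1 / conj (f (1 / conj w))`. -/
noncomputable def circleReflection (f : ℂ → ℂ) (w : ℂ) : ℂ :=
  (conj (f (conj w⁻¹)))⁻¹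

lemma circleReflection_eq_self {f : ℂ → ℂ} {w : ℂ} (hw : ‖w‖ = 1) (hf : ‖f w‖ = 1) :
    circleReflection f w = f w := by
  rw [circleReflection, inv_eq_conj hw, conj_conj, inv_eq_conj (by simpa using hf), conj_conj]

lemma ContinuousOn.circleReflection {f : ℂ → ℂ} {s t : Set ℂ} (hf : ContinuousOn f s)
    (hst : MapsTo (fun w : ℂ ↦ conj w⁻¹) t s) (h0 : ∀ w ∈ t, w ≠ 0)
    (hne : ∀ w ∈ t, f (conj w⁻¹) ≠ 0) : ContinuousOn (circleReflection f) t := by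
  have h1 : ContinuousOn (fun w : ℂ ↦ conj w⁻¹) t :=
    continuous_conj.comp_continuousOn (continuousOn_id.inv₀ h0)
  exact (continuous_conj.comp_continuousOn (hf.comp h1 hst)).inv₀ fun w hw ↦ by
    simpa using hne w hw

lemma DifferentiableAt.circleReflection {f : ℂ → ℂ} {w : ℂ}
    (hf : DifferentiableAt ℂ f (conj w⁻¹)) (h0 : w ≠ 0) (hne : f (conj w⁻¹) ≠ 0) :
    DifferentiableAt ℂ (circleReflection f) w := by
  have h1 : DifferentiableAt ℂ (conj ∘ f ∘ conj) w⁻¹ := by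
    simpa using hf.conj_conj
  exact (h1.comp w (differentiableAt_inv h0)).inv (by simpa using hne)

/-- A continuous function on the closed unit disc without zeros on the unit circle has no zeros
in a whole annulus inside the circle. -/
lemma exists_radius_forall_ne_zero {f : ℂ → ℂ} (hfc : ContinuousOn f (closedBall 0 1))
    (hmod : ∀ ζ : ℂ, ‖ζ‖ = 1 → f ζ ≠ 0) :
    ∃ r : ℝ, 0 < r ∧ r < 1 ∧ ∀ z : ℂ, r ≤ ‖z‖ → ‖z‖ ≤ 1 → f z ≠ 0 := by
  have hcl : IsClosed (closedBall (0 : ℂ) 1 ∩ f ⁻¹' {0}) :=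
    hfc.preimage_isClosed_of_isClosed isClosed_closedBall isClosed_singleton
  have hsub : closedBall (0 : ℂ) 1 ∩ f ⁻¹' {0} ⊆ ball 0 1 := by
    rintro z ⟨hz, hz0⟩
    rw [mem_closedBall_zero_iff] at hz
    rw [mem_ball_zero_iff]
    exact hz.lt_of_ne fun h ↦ hmod z h hz0
  obtain ⟨r, ⟨hr0, hr1⟩, hr⟩ := exists_pos_lt_subset_ball one_pos hcl hsub
  refine ⟨r, hr0, hr1, fun z hrz hz h ↦ ?_⟩
  have := hr ⟨mem_closedBall_zero_iff.2 hz, h⟩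
  rw [mem_ball_zero_iff] at this
  exact this.not_ge hrz

/-- The Cauchy integral over a circle is holomorphic in the disc it bounds. -/
lemma CircleIntegrable.differentiableOn_cauchyIntegral {f : ℂ → ℂ} {c : ℂ} {R : ℝ} (hR : 0 < R)
    (hf : CircleIntegrable f c R) :
    DifferentiableOn ℂ (fun w ↦ (2 * π * I : ℂ)⁻¹ • ∮ z in C(c, R), (z - w)⁻¹ • f z)
      (ball c R) := by
  lift R to NNReal using hR.le
  simpa using (hasFPowerSeriesOn_cauchy_integral hf (by exact_mod_cast hR)).differentiableOn

/-- Inner functions on the disc extend holomorphically across the boundary: a continuous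
function on the closed unit disc, holomorphic in the open disc, of modulus one on the
unit circle, is the restriction of a function holomorphic on an open neighbourhood of the
closed disc. -/
theorem inner_function_extends_holomorphically (f : ℂ → ℂ)
    (hfc : ContinuousOn f (closedBall 0 1))
    (hfh : DifferentiableOn ℂ f (ball 0 1))
    (hmod : ∀ ζ : ℂ, ‖ζ‖ = 1 → ‖f ζ‖ = 1) :
    ∃ (V : Set ℂ) (g : ℂ → ℂ),
      IsOpen V ∧ closedBall (0:ℂ) 1 ⊆ V ∧
      DifferentiableOn ℂ g V ∧
      ∀ ζ ∈ closedBall (0:ℂ) 1, g ζ = f ζ := by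
  obtain ⟨r, hr0, hr1, hne⟩ := exists_radius_forall_ne_zero hfc fun ζ hζ h ↦ by
    simpa [h] using hmod ζ hζ
  have hR : 1 < r⁻¹ := (one_lt_inv₀ hr0).2 hr1
  have hR0 : 0 < r⁻¹ := inv_pos.2 hr0
  have hFc : ContinuousOn (circleReflection f) (closedBall 0 r⁻¹ \ ball 0 1) := by
    have hw : ∀ w ∈ closedBall (0 : ℂ) r⁻¹ \ ball 0 1, 1 ≤ ‖w‖ ∧ ‖w‖ ≤ r⁻¹ := by
      rintro w ⟨h1, h2⟩
      simp only [mem_closedBall_zero_iff, mem_ball_zero_iff, not_lt] at h1 h2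
      exact ⟨h2, h1⟩
    refine hfc.circleReflection (fun w h ↦ ?_) (fun w h ↦ ?_) fun w h ↦ ?_
    · simpa using inv_le_one_of_one_le₀ (hw w h).1
    · exact norm_pos_iff.1 (one_pos.trans_le (hw w h).1)
    · apply hne
      · simpa using (le_inv_comm₀ hr0 (one_pos.trans_le (hw w h).1)).2 (hw w h).2
      · simpa using inv_le_one_of_one_le₀ (hw w h).1
  have hFd : ∀ w ∈ ball (0 : ℂ) r⁻¹ \ closedBall 0 1,
      DifferentiableAt ℂ (circleReflection f) w := by
    rintro w ⟨h1, h2⟩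
    simp only [mem_closedBall_zero_iff, mem_ball_zero_iff, not_le] at h1 h2
    have hw0 : 0 < ‖w‖ := one_pos.trans h2
    have hlt : ‖conj w⁻¹‖ < 1 := by simpa using inv_lt_one_of_one_lt₀ h2
    refine (hfh.differentiableAt (isOpen_ball.mem_nhds ?_)).circleReflection
      (norm_pos_iff.1 hw0) (hne _ ?_ hlt.le)
    · exact mem_ball_zero_iff.2 hlt
    · simpa using (le_inv_comm₀ hr0 hw0).2 h1.le
  let g : ℂ → ℂ := fun w ↦
    (2 * π * I : ℂ)⁻¹ • ∮ z in C(0, r⁻¹), (z - w)⁻¹ • circleReflection f z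
  have hgd : DifferentiableOn ℂ g (ball 0 r⁻¹) := by
    refine CircleIntegrable.differentiableOn_cauchyIntegral hR0
      ((hFc.mono fun w hw ↦ ?_).circleIntegrable hR0.le)
    rw [mem_sphere_zero_iff_norm] at hw
    simp [hw, hR.le]
  have hV : closedBall (0 : ℂ) 1 ⊆ ball 0 r⁻¹ := closedBall_subset_ball hR
  refine ⟨ball 0 r⁻¹, g, isOpen_ball, hV, hgd, ?_⟩
  have hball : EqOn g f (ball 0 1) := by
    intro w hw
    have hsub : ∀ z ∉ ball (0 : ℂ) 1, z - w ≠ 0 := fun z hz h ↦ hz (sub_eq_zero.1 h ▸ hw)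
    have hshift : (∮ z in C(0, r⁻¹), (z - w)⁻¹ • circleReflection f z) =
        ∮ z in C(0, 1), (z - w)⁻¹ • circleReflection f z := by
      refine circleIntegral_eq_of_differentiable_on_annulus_off_countable one_pos hR.le
        countable_empty ?_ ?_
      · exact ((continuousOn_id.sub continuousOn_const).inv₀ fun z hz ↦ hsub z hz.2).smul hFc
      · rintro z ⟨hz, -⟩
        exact ((differentiableAt_id.sub_const w).inv
          (hsub z fun h ↦ hz.2 (ball_subset_closedBall h))).smul (hFd z hz)
    have hcircle : (∮ z in C(0, 1), (z - w)⁻¹ • circleReflection f z) =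
        ∮ z in C(0, 1), (z - w)⁻¹ • f z :=
      circleIntegral.integral_congr zero_le_one fun z hz ↦ by
        rw [mem_sphere_zero_iff_norm] at hz
        simp only [circleReflection_eq_self hz (hmod z hz)]
    have hdc : DiffContOnCl ℂ f (ball 0 1) :=
      ⟨hfh, by rwa [closure_ball _ one_ne_zero]⟩
    simp only [g]
    rw [hshift, hcircle, hdc.two_pi_i_inv_smul_circleIntegral_sub_inv_smul hw]
  exact fun ζ hζ ↦ hball.of_subset_closure (hgd.continuousOn.mono hV) hfc
    ball_subset_closedBall (closure_ball (0 : ℂ) one_ne_zero).ge hζ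
end
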